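/- arXiv:2106.05808 — 3 statements merged into one kernel-verified Lean document; each statement's English description precedes it below -/
import Mathlib

section
/- For every n ≥ 3, the quantities for consecutive generations of the pseudofractal scale-free web satisfy d_{n+1}^0 = min{3c_n^0, 2c_n^0 + d_n^0, 2c_n^0 + b_n^2, 2c_n^0 + c_n^1, 3c_n^1, c_n^0 + 2d_n^0, c_n^0 + 2c_n^1, c_n^0 + d_n^0 + c_n^1, 2d_n^0 + c_n^1, c_n^0 + c_n^1 + b_n^2, 3d_n^0, 2d_n^0 + b_n^2, c_n^0 + d_n^0 + b_n^2, d_n^0 + b_n^2 + c_n^1, d_n^0 + 2c_n^1}. -/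
/-!
Common definitions: the pseudofractal scale-free web `pfw n` (= `G_n` for `n ≥ 1`)
and the Sierpinski graph `sierp n` (= `S_n` for `n ≥ 1`), together with the
edge-domination notions used in the paper.
-/

open scoped Classical

noncomputable section

/-- A finite graph generation: a finite vertex type, a finite set of edges
(unordered pairs of vertices), and three designated hub/outmost vertices. -/
structure GraphGen : Type 1 where
  V : Type
  fin : Fintype V
  edges : Finset (Sym2 V)
  hubs : Fin 3 → V

attribute [instance] GraphGen.fin

/-- The triangle (complete graph on three vertices), the common first generation. -/
def triangle : GraphGen where
  V := Fin 3
  fin := inferInstance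
  edges := {s((0 : Fin 3), (1 : Fin 3)), s((0 : Fin 3), (2 : Fin 3)), s((1 : Fin 3), (2 : Fin 3))}
  hubs := fun i => i

/-- One iteration step of the pseudofractal scale-free web: for every existing
edge `{u,v}` a new vertex is added and joined to both `u` and `v`. -/
def pfwStep (X : GraphGen) : GraphGen where
  V := X.V ⊕ {e : Sym2 X.V // e ∈ X.edges}
  fin := inferInstance
  edges :=
    X.edges.image (Sym2.map Sum.inl) ∪
      X.edges.attach.biUnion fun e =>
        (Finset.univ.filter fun v : X.V => v ∈ (e : Sym2 X.V)).image fun v =>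
          s((Sum.inl v : X.V ⊕ {e : Sym2 X.V // e ∈ X.edges}), Sum.inr e)
  hubs := fun i => Sum.inl (X.hubs i)

private def pfwAux : ℕ → GraphGen
  | 0 => triangle
  | n + 1 => pfwStep (pfwAux n)

/-- `pfw n` is the pseudofractal scale-free web `G_n` (for `n ≥ 1`):
`G_1` is a triangle and `G_{n+1}` is obtained from `G_n` by adding, for each
edge, a new vertex adjacent to both of its endpoints.  Its hubs are the three
vertices of `G_1`. -/
def pfw (n : ℕ) : GraphGen := pfwAux (n - 1)

/-- The identification relation used to glue three copies of the Sierpinski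
graph: `B^(1) ~ A^(2)`, `C^(1) ~ A^(3)`, `C^(2) ~ B^(3)` (copies indexed by
`0, 1, 2` and outmost vertices `A = hubs 0`, `B = hubs 1`, `C = hubs 2`). -/
def sierpRel (X : GraphGen) : Fin 3 × X.V → Fin 3 × X.V → Prop := fun p q =>
  (p = ((0 : Fin 3), X.hubs 1) ∧ q = ((1 : Fin 3), X.hubs 0)) ∨
  (p = ((0 : Fin 3), X.hubs 2) ∧ q = ((2 : Fin 3), X.hubs 0)) ∨
  (p = ((1 : Fin 3), X.hubs 2) ∧ q = ((2 : Fin 3), X.hubs 1))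

/-- One iteration step of the Sierpinski graph: three disjoint copies of the
previous generation are glued along their outmost vertices. -/
def sierpStep (X : GraphGen) : GraphGen where
  V := Quotient (Relation.EqvGen.setoid (sierpRel X))
  fin := inferInstance
  edges :=
    (Finset.univ : Finset (Fin 3)).biUnion fun t =>
      X.edges.image (Sym2.map fun v => Quotient.mk (Relation.EqvGen.setoid (sierpRel X)) (t, v))
  hubs := fun i => Quotient.mk (Relation.EqvGen.setoid (sierpRel X)) (i, X.hubs i)

private def sierpAux : ℕ → GraphGen
  | 0 => triangle
  | n + 1 => sierpStep (sierpAux n)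

/-- `sierp n` is the Sierpinski graph `S_n` (for `n ≥ 1`):
`S_1` is a triangle, and `S_{n+1}` is obtained by gluing three copies of `S_n`
at their outmost vertices.  Its `hubs` are the three outmost vertices. -/
def sierp (n : ℕ) : GraphGen := sierpAux (n - 1)

/-- An edge `e` is dominated by the edge set `F` if it belongs to `F` or
shares an endpoint with some edge of `F`. -/
def Dominated (X : GraphGen) (F : Finset (Sym2 X.V)) (e : Sym2 X.V) : Prop :=
  e ∈ F ∨ ∃ f ∈ F, ∃ v, v ∈ e ∧ v ∈ f

/-- `F` is an edge dominating set: a set of edges of `X` such that every edge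
not in `F` shares an endpoint with some edge of `F`. -/
def IsEDS (X : GraphGen) (F : Finset (Sym2 X.V)) : Prop :=
  F ⊆ X.edges ∧ ∀ e ∈ X.edges, e ∉ F → ∃ f ∈ F, ∃ v, v ∈ e ∧ v ∈ f

/-- The edge domination number: the minimum cardinality of an edge dominating set. -/
def edsNum (X : GraphGen) : ℕ := sInf {k | ∃ F, IsEDS X F ∧ F.card = k}

/-- A minimum edge dominating set: an EDS whose cardinality equals the edge
domination number. -/
def IsMEDS (X : GraphGen) (F : Finset (Sym2 X.V)) : Prop :=
  IsEDS X F ∧ F.card = edsNum X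

/-- Hub number `i` is filled w.r.t. `F`: some edge incident to it lies in `F`. -/
def FilledHub (X : GraphGen) (F : Finset (Sym2 X.V)) (i : Fin 3) : Prop :=
  ∃ f ∈ F, X.hubs i ∈ f

/-- Hub number `i` is cross w.r.t. `F`: no edge incident to it lies in `F` and
some edge incident to it is not dominated by `F`. -/
def CrossHub (X : GraphGen) (F : Finset (Sym2 X.V)) (i : Fin 3) : Prop :=
  ¬ FilledHub X F i ∧ ∃ e ∈ X.edges, X.hubs i ∈ e ∧ ¬ Dominated X F e

/-- Hub number `i` is empty w.r.t. `F`: it is neither filled nor cross. -/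
def EmptyHub (X : GraphGen) (F : Finset (Sym2 X.V)) (i : Fin 3) : Prop :=
  ¬ FilledHub X F i ∧ ¬ CrossHub X F i

/-- `F` is admissible: a set of edges of `X` such that every edge not dominated
by `F` is incident to a cross hub vertex. -/
def Admissible (X : GraphGen) (F : Finset (Sym2 X.V)) : Prop :=
  F ⊆ X.edges ∧
    ∀ e ∈ X.edges, ¬ Dominated X F e → ∃ i, CrossHub X F i ∧ X.hubs i ∈ e

/-- The number of filled hub vertices w.r.t. `F`. -/
def numFilled (X : GraphGen) (F : Finset (Sym2 X.V)) : ℕ :=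
  (Finset.univ.filter fun i : Fin 3 => FilledHub X F i).card

/-- The number of cross hub vertices w.r.t. `F`. -/
def numCross (X : GraphGen) (F : Finset (Sym2 X.V)) : ℕ :=
  (Finset.univ.filter fun i : Fin 3 => CrossHub X F i).card

/-- `minAdm X nf i` is the minimum cardinality of an admissible set with exactly
`nf` filled hub vertices and exactly `i` cross hub vertices. -/
def minAdm (X : GraphGen) (nf i : ℕ) : ℕ :=
  sInf {k | ∃ F, Admissible X F ∧ numFilled X F = nf ∧ numCross X F = i ∧ F.card = k}

/-- The class of admissible sets with exactly `nf` filled and exactly `i` cross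
hub vertices attaining the minimum cardinality among such sets. -/
def admClass (X : GraphGen) (nf i : ℕ) : Set (Finset (Sym2 X.V)) :=
  {F | Admissible X F ∧ numFilled X F = nf ∧ numCross X F = i ∧ F.card = minAdm X nf i}

/-- `a_n^i`: minimum cardinality of an admissible set with no filled hub and `i` cross hubs. -/
def aq (X : GraphGen) (i : ℕ) : ℕ := minAdm X 0 i

/-- `b_n^i`: minimum cardinality of an admissible set with one filled hub and `i` cross hubs. -/
def bq (X : GraphGen) (i : ℕ) : ℕ := minAdm X 1 i

/-- `c_n^i`: minimum cardinality of an admissible set with two filled hubs and `i` cross hubs. -/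
def cq (X : GraphGen) (i : ℕ) : ℕ := minAdm X 2 i

/-- `d_n^i`: minimum cardinality of an admissible set with three filled hubs and `i` cross hubs. -/
def dq (X : GraphGen) (i : ℕ) : ℕ := minAdm X 3 i

end

/-- A vertex is covered by a set of edges if it is an endpoint of one of them. -/
def Covered {V : Type} (F : Finset (Sym2 V)) (v : V) : Prop := ∃ f ∈ F, v ∈ f

theorem dominated_iff (X : GraphGen) (F : Finset (Sym2 X.V)) (e : Sym2 X.V) :
    Dominated X F e ↔ ∃ v ∈ e, Covered F v := by
  constructor
  · rintro (h | ⟨f, hf, v, hv, hvf⟩)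
    · exact ⟨_, e.out_fst_mem, e, h, e.out_fst_mem⟩
    · exact ⟨v, hv, f, hf, hvf⟩
  · rintro ⟨v, hv, f, hf, hvf⟩
    exact Or.inr ⟨f, hf, v, hv, hvf⟩

theorem filledHub_iff (X : GraphGen) (F : Finset (Sym2 X.V)) (i : Fin 3) :
    FilledHub X F i ↔ Covered F (X.hubs i) := Iff.rfl

/-- A map of vertices that sends edges to edges. -/
def PreservesEdges (X Y : GraphGen) (f : X.V → Y.V) : Prop :=
  ∀ e ∈ X.edges, Sym2.map f e ∈ Y.edges

/-- The hubs are distinct and pairwise adjacent, and there are no loops. -/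
structure Regular (X : GraphGen) : Prop where
  hubs_inj : Function.Injective X.hubs
  loopless : ∀ e ∈ X.edges, ¬ e.IsDiag
  hubs_adj : ∀ i j, i ≠ j → s(X.hubs i, X.hubs j) ∈ X.edges

theorem mem_triangle_edges (e : Sym2 (Fin 3)) :
    e ∈ triangle.edges ↔ ∃ t : Fin 3, e = s(t, t + 1) := by
  change e ∈ ({s(0, 1), s(0, 2), s(1, 2)} : Finset (Sym2 (Fin 3))) ↔ _
  simp only [Finset.mem_insert, Finset.mem_singleton, Fin.exists_fin_succ, Fin.exists_fin_zero]
  have h : s((2 : Fin 3), 2 + 1) = s(0, 2) := by decide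
  change _ ↔ e = s(0, 1) ∨ e = s(1, 2) ∨ e = s(2, 2 + 1) ∨ False
  rw [h]
  tauto

theorem regular_triangle : Regular triangle where
  hubs_inj := fun _ _ h => h
  loopless := by
    intro e he
    obtain ⟨t, rfl⟩ := (mem_triangle_edges e).1 he
    change ¬ (s(t, t + 1) : Sym2 (Fin 3)).IsDiag
    clear he
    revert t
    decide
  hubs_adj := by
    intro i j hij
    refine (mem_triangle_edges s(i, j)).2 ?_
    revert i j
    decide

/-- The copy of a vertex in the next generation. -/
def oldVertex {X : GraphGen} (v : X.V) : (pfwStep X).V := Sum.inl v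

/-- The vertex of the next generation attached to an edge. -/
def newVertex {X : GraphGen} (d : {e : Sym2 X.V // e ∈ X.edges}) : (pfwStep X).V := Sum.inr d

theorem oldVertex_injective {X : GraphGen} : Function.Injective (oldVertex (X := X)) :=
  Sum.inl_injective

theorem newVertex_injective {X : GraphGen} : Function.Injective (newVertex (X := X)) :=
  Sum.inr_injective

theorem oldVertex_ne_newVertex {X : GraphGen} (v : X.V) (d : {e : Sym2 X.V // e ∈ X.edges}) :
    oldVertex v ≠ newVertex d :=
  Sum.inl_ne_inr

theorem pfwStep_vertex_cases {X : GraphGen} (v : (pfwStep X).V) :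
    (∃ u, v = oldVertex u) ∨ ∃ d, v = newVertex d := by
  rcases v with u | d
  · exact Or.inl ⟨u, rfl⟩
  · exact Or.inr ⟨d, rfl⟩

theorem mem_pfwStep_edges {X : GraphGen} (e : Sym2 (pfwStep X).V) :
    e ∈ (pfwStep X).edges ↔ (∃ d ∈ X.edges, Sym2.map oldVertex d = e) ∨
      ∃ d : {e : Sym2 X.V // e ∈ X.edges}, ∃ v ∈ d.1, s(oldVertex v, newVertex d) = e := by
  suffices h : ∀ e : Sym2 (X.V ⊕ {e : Sym2 X.V // e ∈ X.edges}),
      e ∈ X.edges.image (Sym2.map Sum.inl) ∪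
        X.edges.attach.biUnion (fun d =>
          (Finset.univ.filter fun v : X.V => v ∈ (d : Sym2 X.V)).image fun v =>
            s((Sum.inl v : X.V ⊕ {e : Sym2 X.V // e ∈ X.edges}), Sum.inr d)) ↔
      (∃ d ∈ X.edges, Sym2.map Sum.inl d = e) ∨
        ∃ d : {e : Sym2 X.V // e ∈ X.edges}, ∃ v ∈ d.1, s(Sum.inl v, Sum.inr d) = e from h e
  intro e
  simp

theorem oldVertex_edge_mem {X : GraphGen} {e : Sym2 X.V} (he : e ∈ X.edges) :
    Sym2.map oldVertex e ∈ (pfwStep X).edges :=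
  (mem_pfwStep_edges _).2 (Or.inl ⟨e, he, rfl⟩)

theorem newVertex_edge_mem {X : GraphGen} (d : {e : Sym2 X.V // e ∈ X.edges}) {v : X.V}
    (hv : v ∈ d.1) : s(oldVertex v, newVertex d) ∈ (pfwStep X).edges :=
  (mem_pfwStep_edges _).2 (Or.inr ⟨d, v, hv, rfl⟩)

theorem Regular.step {X : GraphGen} (hX : Regular X) : Regular (pfwStep X) where
  hubs_inj := fun i j h => hX.hubs_inj (oldVertex_injective h)
  loopless := by
    intro e he
    rcases (mem_pfwStep_edges e).1 he with ⟨d, hd, rfl⟩ | ⟨d, v, hv, rfl⟩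
    · rw [Sym2.isDiag_map oldVertex_injective]
      exact hX.loopless d hd
    · exact oldVertex_ne_newVertex v d
  hubs_adj := fun i j hij => oldVertex_edge_mem (hX.hubs_adj i j hij)

/-- The map induced on the next generation by an edge preserving map. -/
def stepMap {X Y : GraphGen} (f : X.V → Y.V) (hf : PreservesEdges X Y f) :
    (pfwStep X).V → (pfwStep Y).V :=
  Sum.map f fun e => ⟨Sym2.map f e.1, hf e.1 e.2⟩

theorem stepMap_injective {X Y : GraphGen} {f : X.V → Y.V} (hf : PreservesEdges X Y f)
    (hinj : Function.Injective f) : Function.Injective (stepMap f hf) := by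
  refine Sum.map_injective.2 ⟨hinj, fun a b h => Subtype.ext ?_⟩
  exact Sym2.map.injective hinj (congrArg Subtype.val h)

theorem map_stepMap_oldVertex {X Y : GraphGen} {f : X.V → Y.V} (hf : PreservesEdges X Y f)
    (e : Sym2 X.V) :
    Sym2.map (stepMap f hf) (Sym2.map oldVertex e) = Sym2.map oldVertex (Sym2.map f e) := by
  induction e with | _ a b => rfl

theorem preservesEdges_stepMap {X Y : GraphGen} {f : X.V → Y.V} (hf : PreservesEdges X Y f) :
    PreservesEdges (pfwStep X) (pfwStep Y) (stepMap f hf) := by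
  intro e he
  rcases (mem_pfwStep_edges e).1 he with ⟨d, hd, rfl⟩ | ⟨d, v, hv, rfl⟩
  · rw [map_stepMap_oldVertex]
    exact oldVertex_edge_mem (hf d hd)
  · exact newVertex_edge_mem (X := Y) ⟨Sym2.map f d.1, hf d.1 d.2⟩
      (Sym2.mem_map.2 ⟨v, hv, rfl⟩)

/-- Every permutation of the hubs extends to an automorphism. -/
def HubSymmetric (X : GraphGen) : Prop :=
  ∀ σ : Equiv.Perm (Fin 3), ∃ f : X.V → X.V, Function.Injective f ∧ PreservesEdges X X f ∧
    ∀ i, f (X.hubs i) = X.hubs (σ i)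

theorem hubSymmetric_triangle : HubSymmetric triangle := by
  intro σ
  refine ⟨σ, σ.injective, ?_, fun i => rfl⟩
  intro e he
  induction e with | _ a b =>
  have hab : a ≠ b := regular_triangle.loopless _ he
  exact regular_triangle.hubs_adj (σ a) (σ b) (σ.injective.ne hab)

theorem HubSymmetric.step {X : GraphGen} (hX : HubSymmetric X) : HubSymmetric (pfwStep X) := by
  intro σ
  obtain ⟨f, hinj, hf, hh⟩ := hX σ
  exact ⟨stepMap f hf, stepMap_injective hf hinj, preservesEdges_stepMap hf,
    fun i => congrArg oldVertex (hh i)⟩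

/-- `Y` is covered by three copies of `X`; copy `t` has its first two hubs at the hubs `t` and
`t + 1` of `Y`, and different copies meet only in these hubs. -/
structure Gluing (X Y : GraphGen) where
  copy : Fin 3 → X.V → Y.V
  preserves : ∀ t, PreservesEdges X Y (copy t)
  inj : ∀ t, Function.Injective (copy t)
  cover : ∀ e ∈ Y.edges, ∃ t, ∃ d ∈ X.edges, Sym2.map (copy t) d = e
  hub_zero : ∀ t, copy t (X.hubs 0) = Y.hubs t
  hub_one : ∀ t, copy t (X.hubs 1) = Y.hubs (t + 1)
  meet : ∀ s t v w, copy s v = copy t w → s ≠ t → v = X.hubs 0 ∨ v = X.hubs 1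

theorem Gluing.edges_disjoint {X Y : GraphGen} (g : Gluing X Y) (hX : Regular X)
    (hY : Regular Y) {s t : Fin 3} {d e : Sym2 X.V} (hd : d ∈ X.edges)
    (h : Sym2.map (g.copy s) d = Sym2.map (g.copy t) e) : s = t := by
  by_contra hst
  have shared : ∀ v ∈ d, v = X.hubs 0 ∨ v = X.hubs 1 := by
    intro v hv
    have : g.copy s v ∈ Sym2.map (g.copy t) e := h ▸ Sym2.mem_map.2 ⟨v, hv, rfl⟩
    obtain ⟨w, -, hw⟩ := Sym2.mem_map.1 this
    exact g.meet s t v w hw.symm hst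
  have ends : ∀ v ∈ d, g.copy s v = Y.hubs t ∨ g.copy s v = Y.hubs (t + 1) := by
    intro v hv
    have : g.copy s v ∈ Sym2.map (g.copy t) e := h ▸ Sym2.mem_map.2 ⟨v, hv, rfl⟩
    obtain ⟨w, -, hw⟩ := Sym2.mem_map.1 this
    rcases g.meet t s w v hw (Ne.symm hst) with rfl | rfl
    · exact Or.inl (hw.symm.trans (g.hub_zero t))
    · exact Or.inr (hw.symm.trans (g.hub_one t))
  have h0 : X.hubs 0 ∈ d ∧ X.hubs 1 ∈ d := by
    have hl := hX.loopless d hd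
    induction d with | _ a b =>
    have ha := shared a (by simp)
    have hb := shared b (by simp)
    rw [Sym2.mk_isDiag_iff] at hl
    rcases ha with rfl | rfl <;> rcases hb with rfl | rfl <;> simp_all
  have e0 := ends _ h0.1
  have e1 := ends _ h0.2
  rw [g.hub_zero, hY.hubs_inj.eq_iff, hY.hubs_inj.eq_iff] at e0
  rw [g.hub_one, hY.hubs_inj.eq_iff, hY.hubs_inj.eq_iff] at e1
  revert hst e0 e1
  clear * -
  revert s t
  decide

/-- The three copies in the next generation. -/
def Gluing.step {X Y : GraphGen} (g : Gluing X Y) (hX : Regular X) (hY : Regular Y) :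
    Gluing (pfwStep X) (pfwStep Y) where
  copy t := stepMap (g.copy t) (g.preserves t)
  preserves t := preservesEdges_stepMap _
  inj t := stepMap_injective _ (g.inj t)
  cover := by
    intro e he
    rcases (mem_pfwStep_edges e).1 he with ⟨d, hd, rfl⟩ | ⟨⟨d, hd⟩, v, hv, rfl⟩
    · obtain ⟨t, c, hc, rfl⟩ := g.cover d hd
      exact ⟨t, _, oldVertex_edge_mem hc, map_stepMap_oldVertex _ _⟩
    · obtain ⟨t, c, hc, rfl⟩ := g.cover d hd
      obtain ⟨u, hu, rfl⟩ := Sym2.mem_map.1 hv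
      exact ⟨t, _, newVertex_edge_mem ⟨c, hc⟩ hu, rfl⟩
  hub_zero t := congrArg oldVertex (g.hub_zero t)
  hub_one t := congrArg oldVertex (g.hub_one t)
  meet := by
    intro s t v w h hst
    rcases pfwStep_vertex_cases v with ⟨v, rfl⟩ | ⟨d, rfl⟩ <;>
      rcases pfwStep_vertex_cases w with ⟨w, rfl⟩ | ⟨e, rfl⟩
    · rcases g.meet s t v w (oldVertex_injective h) hst with rfl | rfl
      · exact Or.inl rfl
      · exact Or.inr rfl
    · cases h
    · cases h
    · have h' := congrArg Subtype.val (newVertex_injective h)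
      exact absurd (g.edges_disjoint hX hY d.2 h') hst

/-- The second generation consists of three triangles. -/
def gluingTriangle : Gluing triangle (pfwStep triangle) where
  copy t := ![oldVertex (triangle.hubs t), oldVertex (triangle.hubs (t + 1)),
    newVertex ⟨_, regular_triangle.hubs_adj t (t + 1) (by revert t; decide)⟩]
  preserves := by
    intro t e he
    obtain ⟨i, rfl⟩ := (mem_triangle_edges e).1 he
    fin_cases i
    · exact oldVertex_edge_mem (regular_triangle.hubs_adj t (t + 1) (by revert t; decide))
    · exact newVertex_edge_mem _ (Sym2.mem_mk_right _ _)
    · refine Eq.mp (congrArg (· ∈ (pfwStep triangle).edges) Sym2.eq_swap) ?_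
      exact newVertex_edge_mem ⟨_, regular_triangle.hubs_adj t (t + 1) (by revert t; decide)⟩
        (Sym2.mem_mk_left _ _)
  inj := by
    intro t i j h
    change Fin 3 at i j
    have ht : t ≠ t + 1 := by clear h; revert t; decide
    fin_cases i <;> fin_cases j
    · rfl
    · exact absurd (oldVertex_injective h) ht
    · exact absurd h (oldVertex_ne_newVertex _ _)
    · exact absurd (oldVertex_injective h).symm ht
    · rfl
    · exact absurd h (oldVertex_ne_newVertex _ _)
    · exact absurd h.symm (oldVertex_ne_newVertex _ _)
    · exact absurd h.symm (oldVertex_ne_newVertex _ _)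
    · rfl
  cover := by
    intro e he
    rcases (mem_pfwStep_edges e).1 he with ⟨d, hd, rfl⟩ | ⟨⟨d, hd⟩, v, hv, rfl⟩
    · obtain ⟨t, rfl⟩ := (mem_triangle_edges d).1 hd
      exact ⟨t, _, regular_triangle.hubs_adj 0 1 (by decide), rfl⟩
    · obtain ⟨t, rfl⟩ := (mem_triangle_edges d).1 hd
      rcases Sym2.mem_iff.1 hv with rfl | rfl
      · exact ⟨_, _, regular_triangle.hubs_adj 0 2 (by decide), rfl⟩
      · exact ⟨t, _, regular_triangle.hubs_adj 1 2 (by decide), rfl⟩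
  hub_zero t := rfl
  hub_one t := rfl
  meet := by
    intro s t i j h hst
    change Fin 3 at i j
    fin_cases i
    · exact Or.inl rfl
    · exact Or.inr rfl
    · exfalso
      fin_cases j
      · exact oldVertex_ne_newVertex _ _ h.symm
      · exact oldVertex_ne_newVertex _ _ h.symm
      · have h' : (s(s, s + 1) : Sym2 (Fin 3)) = s(t, t + 1) :=
          congrArg Subtype.val (newVertex_injective h)
        revert hst h'
        clear * -
        revert s t
        decide

/-- Each pair of hubs has a common neighbour with no other neighbours, and for every edge and
each of its endpoints there is an edge meeting it and avoiding that endpoint. -/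
structure HasTips (X : GraphGen) : Prop where
  tip : ∀ i j, i ≠ j → ∃ p, (∀ k, p ≠ X.hubs k) ∧ s(X.hubs i, p) ∈ X.edges ∧
    ∀ e ∈ X.edges, p ∈ e → X.hubs i ∈ e ∨ X.hubs j ∈ e
  bypass : ∀ e ∈ X.edges, ∀ u ∈ e, ∃ v ∈ e, ∃ d ∈ X.edges, v ∈ d ∧ u ∉ d

theorem Regular.hasTips_step {X : GraphGen} (hX : Regular X) : HasTips (pfwStep X) where
  tip := by
    intro i j hij
    have hm := hX.hubs_adj i j hij
    refine ⟨newVertex ⟨_, hm⟩, fun k h => oldVertex_ne_newVertex _ _ h.symm,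
      newVertex_edge_mem ⟨_, hm⟩ (Sym2.mem_mk_left _ _), ?_⟩
    intro e he hp
    rcases (mem_pfwStep_edges e).1 he with ⟨d, hd, rfl⟩ | ⟨d, v, hv, rfl⟩
    · obtain ⟨w, -, hw⟩ := Sym2.mem_map.1 hp
      exact absurd hw (oldVertex_ne_newVertex _ _)
    · rcases Sym2.mem_iff.1 hp with h | h
      · exact absurd h.symm (oldVertex_ne_newVertex _ _)
      · cases newVertex_injective h
        rcases Sym2.mem_iff.1 hv with rfl | rfl
        · exact Or.inl (Sym2.mem_mk_left _ _)
        · exact Or.inr (Sym2.mem_mk_left _ _)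
  bypass := by
    intro e he u hu
    rcases (mem_pfwStep_edges e).1 he with ⟨d, hd, rfl⟩ | ⟨d, v, hv, rfl⟩
    · obtain ⟨u, ⟨v, rfl⟩, rfl⟩ := Sym2.mem_map.1 hu
      refine ⟨oldVertex v, Sym2.mem_mk_right _ _, _,
        newVertex_edge_mem ⟨_, hd⟩ (Sym2.mem_mk_right u v), Sym2.mem_mk_left _ _, ?_⟩
      rw [Sym2.mem_iff]
      rintro (h | h)
      · exact hX.loopless _ hd (oldVertex_injective h)
      · exact oldVertex_ne_newVertex _ _ h
    · rcases Sym2.mem_iff.1 hu with rfl | rfl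
      · obtain ⟨d, hd⟩ := d
        obtain ⟨w, rfl⟩ := hv
        refine ⟨_, Sym2.mem_mk_right _ _, _, newVertex_edge_mem ⟨_, hd⟩ (Sym2.mem_mk_right v w),
          Sym2.mem_mk_right _ _, ?_⟩
        rw [Sym2.mem_iff]
        rintro (h | h)
        · exact hX.loopless _ hd (oldVertex_injective h)
        · exact oldVertex_ne_newVertex _ _ h
      · refine ⟨_, Sym2.mem_mk_left _ _, _, oldVertex_edge_mem d.2,
          Sym2.mem_map.2 ⟨v, hv, rfl⟩, ?_⟩
        intro h
        obtain ⟨w, -, hw⟩ := Sym2.mem_map.1 h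
        exact oldVertex_ne_newVertex _ _ hw

theorem pfw_succ {n : ℕ} (hn : 1 ≤ n) : pfw (n + 1) = pfwStep (pfw n) := by
  obtain ⟨m, rfl⟩ := Nat.exists_eq_add_of_le' hn
  rfl

theorem pfw_regular {n : ℕ} (hn : 1 ≤ n) : Regular (pfw n) := by
  induction n, hn using Nat.le_induction with
  | base => exact regular_triangle
  | succ n hn ih => rw [pfw_succ hn]; exact ih.step

theorem pfw_hubSymmetric {n : ℕ} (hn : 1 ≤ n) : HubSymmetric (pfw n) := by
  induction n, hn using Nat.le_induction with
  | base => exact hubSymmetric_triangle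
  | succ n hn ih => rw [pfw_succ hn]; exact ih.step

theorem pfw_hasTips {n : ℕ} (hn : 2 ≤ n) : HasTips (pfw n) := by
  obtain ⟨m, rfl⟩ := Nat.exists_eq_add_of_le' hn
  exact (pfw_regular (n := m + 1) (by omega)).hasTips_step

theorem pfw_gluing {n : ℕ} (hn : 1 ≤ n) : Nonempty (Gluing (pfw n) (pfw (n + 1))) := by
  induction n, hn using Nat.le_induction with
  | base => exact ⟨gluingTriangle⟩
  | succ n hn ih =>
    obtain ⟨g⟩ := ih
    have h := g.step (pfw_regular hn) (pfw_regular (by omega))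
    rw [pfw_succ (n := n + 1) (by omega)]
    rw [← pfw_succ hn] at h
    exact ⟨h⟩

theorem PreservesEdges.surjOn {X : GraphGen} {f : X.V → X.V} (hf : PreservesEdges X X f)
    (hinj : Function.Injective f) {e : Sym2 X.V} (he : e ∈ X.edges) :
    ∃ d ∈ X.edges, Sym2.map f d = e := by
  have h : X.edges.image (Sym2.map f) = X.edges := by
    refine Finset.eq_of_subset_of_card_le (Finset.image_subset_iff.2 hf) ?_
    rw [Finset.card_image_of_injective _ (Sym2.map.injective hinj)]
  rw [← h] at he
  exact Finset.mem_image.1 he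

theorem covered_image_iff {V W : Type} {f : V → W} (hf : Function.Injective f)
    (F : Finset (Sym2 V)) (v : V) : Covered (F.image (Sym2.map f)) (f v) ↔ Covered F v := by
  constructor
  · rintro ⟨e, he, hv⟩
    obtain ⟨d, hd, rfl⟩ := Finset.mem_image.1 he
    obtain ⟨w, hw, hwv⟩ := Sym2.mem_map.1 hv
    exact ⟨d, hd, hf hwv ▸ hw⟩
  · rintro ⟨d, hd, hv⟩
    exact ⟨_, Finset.mem_image_of_mem _ hd, Sym2.mem_map.2 ⟨v, hv, rfl⟩⟩

theorem dominated_image_iff {X Y : GraphGen} {f : X.V → Y.V} (hf : Function.Injective f)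
    (F : Finset (Sym2 X.V)) (e : Sym2 X.V) :
    Dominated Y (F.image (Sym2.map f)) (Sym2.map f e) ↔ Dominated X F e := by
  rw [dominated_iff, dominated_iff]
  constructor
  · rintro ⟨v, hv, hc⟩
    obtain ⟨w, hw, rfl⟩ := Sym2.mem_map.1 hv
    exact ⟨w, hw, (covered_image_iff hf F w).1 hc⟩
  · rintro ⟨w, hw, hc⟩
    exact ⟨f w, Sym2.mem_map.2 ⟨w, hw, rfl⟩, (covered_image_iff hf F w).2 hc⟩

/-- Admissible sets can be transported along permutations of the hubs. -/
theorem HubSymmetric.transport {X : GraphGen} (hX : HubSymmetric X) (σ : Equiv.Perm (Fin 3))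
    {F : Finset (Sym2 X.V)} (hF : Admissible X F) :
    ∃ F', Admissible X F' ∧ F'.card = F.card ∧
      (∀ i, FilledHub X F' (σ i) ↔ FilledHub X F i) ∧
      ∀ i, CrossHub X F' (σ i) ↔ CrossHub X F i := by
  obtain ⟨f, hinj, hf, hh⟩ := hX σ
  have hfill : ∀ i, FilledHub X (F.image (Sym2.map f)) (σ i) ↔ FilledHub X F i := by
    intro i
    rw [filledHub_iff, filledHub_iff, ← hh i]
    exact covered_image_iff hinj F _
  have hcross : ∀ i, CrossHub X (F.image (Sym2.map f)) (σ i) ↔ CrossHub X F i := by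
    intro i
    refine and_congr (not_congr (hfill i)) ?_
    rw [← hh i]
    constructor
    · rintro ⟨e, he, hi, hd⟩
      obtain ⟨d, hd', rfl⟩ := hf.surjOn hinj he
      obtain ⟨v, hv, hvi⟩ := Sym2.mem_map.1 hi
      exact ⟨d, hd', hinj hvi ▸ hv, (not_congr (dominated_image_iff hinj F d)).1 hd⟩
    · rintro ⟨d, hd', hi, hd⟩
      exact ⟨_, hf d hd', Sym2.mem_map.2 ⟨_, hi, rfl⟩,
        (not_congr (dominated_image_iff (Y := X) hinj F d)).2 hd⟩
  refine ⟨F.image (Sym2.map f), ⟨?_, ?_⟩,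
    Finset.card_image_of_injective _ (Sym2.map.injective hinj), hfill, hcross⟩
  · exact Finset.image_subset_iff.2 fun e he => hf e (hF.1 he)
  · intro e he hd
    obtain ⟨d, hd', rfl⟩ := hf.surjOn hinj he
    obtain ⟨i, hi, hid⟩ := hF.2 d hd' ((not_congr (dominated_image_iff hinj F d)).1 hd)
    exact ⟨σ i, (hcross i).2 hi, Sym2.mem_map.2 ⟨_, hid, hh i⟩⟩

theorem card_filter_fin_three_eq_two {P : Fin 3 → Prop} :
    (Finset.univ.filter P).card = 2 ↔ ∃ i, ∀ j, P j ↔ j ≠ i := by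
  simp only [Finset.card_filter, Fin.sum_univ_three, Fin.exists_fin_succ, Fin.forall_fin_succ]
  by_cases h0 : P 0 <;> by_cases h1 : P 1 <;> by_cases h2 : P 2 <;> simp [h0, h1, h2]

theorem card_filter_fin_three_eq_one {P : Fin 3 → Prop} :
    (Finset.univ.filter P).card = 1 ↔ ∃ i, ∀ j, P j ↔ j = i := by
  simp only [Finset.card_filter, Fin.sum_univ_three, Fin.exists_fin_succ, Fin.forall_fin_succ]
  by_cases h0 : P 0 <;> by_cases h1 : P 1 <;> by_cases h2 : P 2 <;> simp [h0, h1, h2]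

theorem card_filter_fin_three_eq_three {P : Fin 3 → Prop} :
    (Finset.univ.filter P).card = 3 ↔ ∀ j, P j := by
  simp only [Finset.card_filter, Fin.sum_univ_three, Fin.forall_fin_succ]
  by_cases h0 : P 0 <;> by_cases h1 : P 1 <;> by_cases h2 : P 2 <;> simp [h0, h1, h2]

theorem card_filter_fin_three_eq_zero {P : Fin 3 → Prop} :
    (Finset.univ.filter P).card = 0 ↔ ∀ j, ¬ P j := by
  simp [Finset.filter_eq_empty_iff]

theorem minAdm_le {X : GraphGen} {nf i : ℕ} {F : Finset (Sym2 X.V)} (hF : Admissible X F)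
    (hf : numFilled X F = nf) (hc : numCross X F = i) : minAdm X nf i ≤ F.card :=
  Nat.sInf_le ⟨F, hF, hf, hc, rfl⟩

theorem exists_card_eq_minAdm {X : GraphGen} {nf i : ℕ}
    (h : ∃ F, Admissible X F ∧ numFilled X F = nf ∧ numCross X F = i) :
    ∃ F, Admissible X F ∧ numFilled X F = nf ∧ numCross X F = i ∧ F.card = minAdm X nf i := by
  obtain ⟨F, hF, hf, hc⟩ := h
  exact Nat.sInf_mem (s := {k | ∃ F, Admissible X F ∧ numFilled X F = nf ∧ numCross X F = i ∧
    F.card = k}) ⟨F.card, F, hF, hf, hc, rfl⟩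

/-- Two adjacent hubs that are not filled are cross. -/
theorem Regular.crossHub {X : GraphGen} (hX : Regular X) {F : Finset (Sym2 X.V)} {i j : Fin 3}
    (hij : i ≠ j) (hi : ¬ FilledHub X F i) (hj : ¬ FilledHub X F j) : CrossHub X F i := by
  refine ⟨hi, _, hX.hubs_adj i j hij, Sym2.mem_mk_left _ _, ?_⟩
  rw [dominated_iff]
  rintro ⟨v, hv, hc⟩
  rcases Sym2.mem_iff.1 hv with rfl | rfl
  · exact hi hc
  · exact hj hc

/-- A set dominating all edges and filling all hubs. -/
def DominatesFilling (X : GraphGen) (F : Finset (Sym2 X.V)) : Prop :=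
  F ⊆ X.edges ∧ (∀ e ∈ X.edges, Dominated X F e) ∧ ∀ i, FilledHub X F i

theorem dominatesFilling_iff (X : GraphGen) (F : Finset (Sym2 X.V)) :
    DominatesFilling X F ↔ Admissible X F ∧ numFilled X F = 3 ∧ numCross X F = 0 := by
  unfold numFilled numCross
  rw [card_filter_fin_three_eq_three, card_filter_fin_three_eq_zero]
  constructor
  · rintro ⟨h1, h2, h3⟩
    exact ⟨⟨h1, fun e he hd => absurd (h2 e he) hd⟩, h3, fun i hi => hi.1 (h3 i)⟩
  · rintro ⟨⟨h1, h2⟩, h3, h4⟩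
    refine ⟨h1, fun e he => ?_, h3⟩
    by_contra hd
    obtain ⟨i, hi, -⟩ := h2 e he hd
    exact h4 i hi

/-! ### Existence of admissible sets -/

theorem Regular.dominatesFilling_edges {X : GraphGen} (hX : Regular X) :
    DominatesFilling X X.edges := by
  refine ⟨subset_rfl, fun e he => Or.inl he, fun i => ?_⟩
  exact ⟨_, hX.hubs_adj i (i + 1) (by revert i; decide), Sym2.mem_mk_left _ _⟩

/-- Deleting a hub's edges leaves that hub empty and the others filled. -/
theorem HasTips.exists_two_zero {X : GraphGen} (hT : HasTips X) (hX : Regular X) :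
    ∃ F, Admissible X F ∧ numFilled X F = 2 ∧ numCross X F = 0 := by
  let F := X.edges.filter fun e => X.hubs 2 ∉ e
  have hdom : ∀ e ∈ X.edges, Dominated X F e := by
    intro e he
    by_cases h2 : X.hubs 2 ∈ e
    · obtain ⟨v, hv, d, hd, hvd, h⟩ := hT.bypass e he _ h2
      exact (dominated_iff X F e).2 ⟨v, hv, d, Finset.mem_filter.2 ⟨hd, h⟩, hvd⟩
    · exact Or.inl (Finset.mem_filter.2 ⟨he, h2⟩)
  have h01 : s(X.hubs 0, X.hubs 1) ∈ F := by
    refine Finset.mem_filter.2 ⟨hX.hubs_adj 0 1 (by decide), ?_⟩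
    rw [Sym2.mem_iff, hX.hubs_inj.eq_iff, hX.hubs_inj.eq_iff]
    decide
  refine ⟨F, ⟨Finset.filter_subset _ _, fun e he hd => absurd (hdom e he) hd⟩, ?_, ?_⟩
  · refine card_filter_fin_three_eq_two.2 ⟨2, fun j => ?_⟩
    fin_cases j
    · exact ⟨fun _ => by decide, fun _ => ⟨_, h01, Sym2.mem_mk_left _ _⟩⟩
    · exact ⟨fun _ => by decide, fun _ => ⟨_, h01, Sym2.mem_mk_right _ _⟩⟩
    · exact ⟨fun ⟨e, he, h⟩ => absurd h (Finset.mem_filter.1 he).2, fun h => absurd rfl h⟩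
  · refine card_filter_fin_three_eq_zero.2 fun i => ?_
    rintro ⟨-, e, he, -, hd⟩
    exact hd (hdom e he)

theorem HasTips.exists_two_one {X : GraphGen} (hT : HasTips X) (hX : Regular X) :
    ∃ F, Admissible X F ∧ numFilled X F = 2 ∧ numCross X F = 1 := by
  obtain ⟨p, hp, hpe, hpn⟩ := hT.tip 2 0 (by decide)
  let F := X.edges.filter fun e => X.hubs 2 ∉ e ∧ p ∉ e
  have h01 : s(X.hubs 0, X.hubs 1) ∈ F := by
    refine Finset.mem_filter.2 ⟨hX.hubs_adj 0 1 (by decide), ?_, ?_⟩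
    · rw [Sym2.mem_iff, hX.hubs_inj.eq_iff, hX.hubs_inj.eq_iff]
      decide
    · rw [Sym2.mem_iff]
      rintro (h | h)
      · exact hp _ h
      · exact hp _ h
  have hfill : ∀ j, FilledHub X F j ↔ j ≠ 2 := by
    intro j
    fin_cases j
    · exact ⟨fun _ => by decide, fun _ => ⟨_, h01, Sym2.mem_mk_left _ _⟩⟩
    · exact ⟨fun _ => by decide, fun _ => ⟨_, h01, Sym2.mem_mk_right _ _⟩⟩
    · exact ⟨fun ⟨e, he, h⟩ => absurd h (Finset.mem_filter.1 he).2.1, fun h => absurd rfl h⟩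
  have hcross : CrossHub X F 2 := by
    refine ⟨fun h => (hfill 2).1 h rfl, _, hpe, Sym2.mem_mk_left _ _, ?_⟩
    rw [dominated_iff]
    rintro ⟨v, hv, d, hd, hvd⟩
    have hd' := (Finset.mem_filter.1 hd).2
    rcases Sym2.mem_iff.1 hv with rfl | rfl
    · exact hd'.1 hvd
    · exact hd'.2 hvd
  refine ⟨F, ⟨Finset.filter_subset _ _, fun e he hd => ⟨2, hcross, ?_⟩⟩, ?_, ?_⟩
  · by_contra h2
    by_cases hpm : p ∈ e
    · rcases hpn e he hpm with h | h
      · exact h2 h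
      · exact hd ((dominated_iff X F e).2 ⟨_, h, (hfill 0).2 (by decide)⟩)
    · exact hd (Or.inl (Finset.mem_filter.2 ⟨he, h2, hpm⟩))
  · exact card_filter_fin_three_eq_two.2 ⟨2, hfill⟩
  · refine card_filter_fin_three_eq_one.2 ⟨2, fun j => ⟨fun h => ?_, fun h => h ▸ hcross⟩⟩
    by_contra hj
    exact h.1 ((hfill j).2 hj)

theorem numCross_of_forall_filledHub_iff {X : GraphGen} (hX : Regular X)
    {F : Finset (Sym2 X.V)} {i : Fin 3} (h : ∀ j, FilledHub X F j ↔ j = i) :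
    numCross X F = 2 := by
  refine card_filter_fin_three_eq_two.2 ⟨i, fun j => ⟨fun hj hji => hj.1 ((h j).2 hji), ?_⟩⟩
  intro hji
  obtain ⟨k, hk, hkj⟩ : ∃ k, k ≠ i ∧ j ≠ k := by
    clear h
    revert i j
    decide
  exact hX.crossHub hkj (fun hf => hji ((h j).1 hf)) fun hf => hk ((h k).1 hf)

theorem HasTips.exists_one_two {X : GraphGen} (hT : HasTips X) (hX : Regular X) :
    ∃ F, Admissible X F ∧ numFilled X F = 1 ∧ numCross X F = 2 := by
  obtain ⟨p, hp, hpe, hpn⟩ := hT.tip 2 0 (by decide)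
  let F := X.edges.filter fun e => X.hubs 0 ∉ e ∧ X.hubs 1 ∉ e
  have h2p : s(X.hubs 2, p) ∈ F := by
    refine Finset.mem_filter.2 ⟨hpe, ?_, ?_⟩ <;>
    · rw [Sym2.mem_iff, hX.hubs_inj.eq_iff]
      rintro (h | h)
      · revert h
        decide
      · exact hp _ h.symm
  have hfill : ∀ j, FilledHub X F j ↔ j = 2 := by
    intro j
    fin_cases j
    · exact ⟨fun ⟨e, he, h⟩ => absurd h (Finset.mem_filter.1 he).2.1, fun h => by cases h⟩
    · exact ⟨fun ⟨e, he, h⟩ => absurd h (Finset.mem_filter.1 he).2.2, fun h => by cases h⟩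
    · exact ⟨fun _ => rfl, fun _ => ⟨_, h2p, Sym2.mem_mk_left _ _⟩⟩
  have h0 : ¬ FilledHub X F 0 := fun h => by cases (hfill 0).1 h
  have h1 : ¬ FilledHub X F 1 := fun h => by cases (hfill 1).1 h
  refine ⟨F, ⟨Finset.filter_subset _ _, fun e he hd => ?_⟩,
    card_filter_fin_three_eq_one.2 ⟨2, hfill⟩, numCross_of_forall_filledHub_iff hX hfill⟩
  by_cases h0e : X.hubs 0 ∈ e
  · exact ⟨0, hX.crossHub (by decide) h0 h1, h0e⟩
  by_cases h1e : X.hubs 1 ∈ e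
  · exact ⟨1, hX.crossHub (by decide) h1 h0, h1e⟩
  exact absurd (Or.inl (Finset.mem_filter.2 ⟨he, h0e, h1e⟩)) hd

/-- There is an admissible set of size `k` in which the hub `2` is not cross, and the hub `0`
(resp. `1`) is filled whenever `P` (resp. `Q`) holds. -/
def Attains (X : GraphGen) (P Q : Prop) (k : ℕ) : Prop :=
  ∃ F, Admissible X F ∧ ¬ CrossHub X F 2 ∧ (P → FilledHub X F 0) ∧ (Q → FilledHub X F 1) ∧
    F.card = k

/-- A permutation of the hubs moving one hub to a prescribed place. -/
theorem HubSymmetric.transport_swap {X : GraphGen} (hX : HubSymmetric X) (i k : Fin 3)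
    {F : Finset (Sym2 X.V)} (hF : Admissible X F) :
    ∃ F', Admissible X F' ∧ F'.card = F.card ∧
      (∀ j, FilledHub X F' j ↔ FilledHub X F (Equiv.swap i k j)) ∧
      ∀ j, CrossHub X F' j ↔ CrossHub X F (Equiv.swap i k j) := by
  obtain ⟨F', h1, h2, h3, h4⟩ := hX.transport (Equiv.swap i k) hF
  refine ⟨F', h1, h2, fun j => ?_, fun j => ?_⟩
  · rw [← h3, Equiv.swap_apply_self]
  · rw [← h4, Equiv.swap_apply_self]

theorem swap_apply_eq_left_iff (i k j : Fin 3) : Equiv.swap i k j = i ↔ j = k := by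
  rw [Equiv.swap_apply_eq_iff, Equiv.swap_apply_left]

theorem attains_dq {X : GraphGen} (hX : Regular X) : Attains X True True (dq X 0) := by
  obtain ⟨F, h, hf, hc, hk⟩ := exists_card_eq_minAdm
    ⟨_, (dominatesFilling_iff X _).1 hX.dominatesFilling_edges⟩
  have hf := card_filter_fin_three_eq_three.1 hf
  exact ⟨F, h, card_filter_fin_three_eq_zero.1 hc 2, fun _ => hf 0, fun _ => hf 1, hk⟩

theorem attains_cq_zero {X : GraphGen} (hX : Regular X) (hT : HasTips X)
    (hS : HubSymmetric X) : Attains X True True (cq X 0) := by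
  obtain ⟨F, h, hf, hc, hk⟩ := exists_card_eq_minAdm (hT.exists_two_zero hX)
  obtain ⟨i, hi⟩ := card_filter_fin_three_eq_two.1 hf
  obtain ⟨F', h', hk', hf', hc'⟩ := hS.transport_swap i 2 h
  have hfill : ∀ j, j ≠ 2 → FilledHub X F' j := by
    intro j hj
    rwa [hf', hi, Ne, swap_apply_eq_left_iff]
  refine ⟨F', h', ?_, fun _ => hfill 0 (by decide), fun _ => hfill 1 (by decide), hk'.trans hk⟩
  rw [hc']
  exact card_filter_fin_three_eq_zero.1 hc _

theorem attains_cq_one {X : GraphGen} (hX : Regular X) (hT : HasTips X)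
    (hS : HubSymmetric X) : Attains X True False (cq X 1) ∧ Attains X False True (cq X 1) := by
  obtain ⟨F, h, hf, hc, hk⟩ := exists_card_eq_minAdm (hT.exists_two_one hX)
  obtain ⟨i, hi⟩ := card_filter_fin_three_eq_two.1 hf
  have key : ∀ m, ∃ F', Admissible X F' ∧ F'.card = cq X 1 ∧ ∀ j, j ≠ m → FilledHub X F' j := by
    intro m
    obtain ⟨F', h', hk', hf', -⟩ := hS.transport_swap i m h
    refine ⟨F', h', hk'.trans hk, fun j hj => ?_⟩
    rwa [hf', hi, Ne, swap_apply_eq_left_iff]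
  constructor
  · obtain ⟨F', h', hk', hf'⟩ := key 1
    exact ⟨F', h', fun hx => hx.1 (hf' 2 (by decide)), fun _ => hf' 0 (by decide), False.elim, hk'⟩
  · obtain ⟨F', h', hk', hf'⟩ := key 0
    exact ⟨F', h', fun hx => hx.1 (hf' 2 (by decide)), False.elim, fun _ => hf' 1 (by decide), hk'⟩

theorem attains_bq {X : GraphGen} (hX : Regular X) (hT : HasTips X)
    (hS : HubSymmetric X) : Attains X False False (bq X 2) := by
  obtain ⟨F, h, hf, hc, hk⟩ := exists_card_eq_minAdm (hT.exists_one_two hX)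
  obtain ⟨i, hi⟩ := card_filter_fin_three_eq_one.1 hf
  obtain ⟨F', h', hk', hf', -⟩ := hS.transport_swap i 2 h
  refine ⟨F', h', fun hx => hx.1 ?_, False.elim, False.elim, hk'.trans hk⟩
  rw [hf', hi, swap_apply_eq_left_iff]

/-! ### Restricting and assembling -/

theorem Gluing.copy_eq_hub {X Y : GraphGen} (g : Gluing X Y) (hY : Regular Y) {s t : Fin 3}
    {v : X.V} (h : g.copy s v = Y.hubs t) :
    (s = t ∧ v = X.hubs 0) ∨ (s + 1 = t ∧ v = X.hubs 1) := by
  by_cases hst : s = t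
  · subst hst
    exact Or.inl ⟨rfl, g.inj s (h.trans (g.hub_zero s).symm)⟩
  · rcases g.meet s t v (X.hubs 0) (h.trans (g.hub_zero t).symm) hst with rfl | rfl
    · exact absurd (hY.hubs_inj ((g.hub_zero s).symm.trans h)) hst
    · exact Or.inr ⟨hY.hubs_inj ((g.hub_one s).symm.trans h), rfl⟩

/-- The union of edge sets of the three copies. -/
noncomputable def Gluing.union {X Y : GraphGen} (g : Gluing X Y) (F : Fin 3 → Finset (Sym2 X.V)) :
    Finset (Sym2 Y.V) :=
  Finset.univ.biUnion fun t => (F t).image (Sym2.map (g.copy t))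

theorem Gluing.mem_union {X Y : GraphGen} (g : Gluing X Y) (F : Fin 3 → Finset (Sym2 X.V))
    (e : Sym2 Y.V) : e ∈ g.union F ↔ ∃ t, ∃ d ∈ F t, Sym2.map (g.copy t) d = e := by
  simp [Gluing.union]

theorem Gluing.card_union {X Y : GraphGen} (g : Gluing X Y) (hX : Regular X) (hY : Regular Y)
    (F : Fin 3 → Finset (Sym2 X.V)) (hF : ∀ t, F t ⊆ X.edges) :
    (g.union F).card = (F 0).card + (F 1).card + (F 2).card := by
  rw [Gluing.union, Finset.card_biUnion, Fin.sum_univ_three]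
  · simp only [Finset.card_image_of_injective _ (Sym2.map.injective (g.inj _))]
  · intro s _ t _ hst
    rw [Function.onFun, Finset.disjoint_left]
    intro e hs ht
    obtain ⟨d, hd, rfl⟩ := Finset.mem_image.1 hs
    obtain ⟨d', -, h⟩ := Finset.mem_image.1 ht
    exact hst (g.edges_disjoint hX hY (hF s hd) h.symm)

theorem Gluing.covered_union {X Y : GraphGen} (g : Gluing X Y)
    (F : Fin 3 → Finset (Sym2 X.V)) (v : Y.V) :
    Covered (g.union F) v ↔ ∃ t w, Covered (F t) w ∧ g.copy t w = v := by
  constructor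
  · rintro ⟨e, he, hv⟩
    obtain ⟨t, d, hd, rfl⟩ := (g.mem_union F e).1 he
    obtain ⟨w, hw, rfl⟩ := Sym2.mem_map.1 hv
    exact ⟨t, w, ⟨d, hd, hw⟩, rfl⟩
  · rintro ⟨t, w, ⟨d, hd, hw⟩, rfl⟩
    exact ⟨_, (g.mem_union F _).2 ⟨t, d, hd, rfl⟩, Sym2.mem_map.2 ⟨w, hw, rfl⟩⟩

theorem Gluing.filledHub_union {X Y : GraphGen} (g : Gluing X Y) (hY : Regular Y)
    (F : Fin 3 → Finset (Sym2 X.V)) (t : Fin 3) :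
    FilledHub Y (g.union F) t ↔ FilledHub X (F t) 0 ∨ FilledHub X (F (t + 2)) 1 := by
  rw [filledHub_iff, g.covered_union]
  have ht : t + 2 + 1 = t := by revert t; decide
  constructor
  · rintro ⟨s, w, hw, h⟩
    rcases g.copy_eq_hub hY h with ⟨rfl, rfl⟩ | ⟨rfl, rfl⟩
    · exact Or.inl hw
    · have hs : s + 1 + 2 = s := by clear * -; revert s; decide
      rw [hs]
      exact Or.inr hw
  · rintro (h | h)
    · exact ⟨t, _, h, g.hub_zero t⟩
    · exact ⟨t + 2, _, h, by rw [g.hub_one, ht]⟩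

theorem Gluing.dominatesFilling_union {X Y : GraphGen} (g : Gluing X Y) (hY : Regular Y)
    (F : Fin 3 → Finset (Sym2 X.V)) (hF : ∀ t, Admissible X (F t))
    (hc : ∀ t, ¬ CrossHub X (F t) 2)
    (hf : ∀ t, FilledHub X (F t) 0 ∨ FilledHub X (F (t + 2)) 1) :
    DominatesFilling Y (g.union F) := by
  have hfill : ∀ t, FilledHub Y (g.union F) t := fun t => (g.filledHub_union hY F t).2 (hf t)
  refine ⟨?_, ?_, hfill⟩
  · intro e he
    obtain ⟨t, d, hd, rfl⟩ := (g.mem_union F e).1 he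
    exact g.preserves t d ((hF t).1 hd)
  · intro e he
    obtain ⟨t, d, hd, rfl⟩ := g.cover e he
    rw [dominated_iff]
    by_cases h : Dominated X (F t) d
    · obtain ⟨v, hv, hcv⟩ := (dominated_iff _ _ _).1 h
      exact ⟨_, Sym2.mem_map.2 ⟨v, hv, rfl⟩, (g.covered_union F _).2 ⟨t, v, hcv, rfl⟩⟩
    · obtain ⟨i, hi, hid⟩ := (hF t).2 d hd h
      refine ⟨_, Sym2.mem_map.2 ⟨_, hid, rfl⟩, ?_⟩
      fin_cases i
      · exact (g.hub_zero t).symm ▸ hfill t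
      · exact (g.hub_one t).symm ▸ hfill (t + 1)
      · exact absurd hi (hc t)

theorem Gluing.dq_le {X Y : GraphGen} (g : Gluing X Y) (hX : Regular X) (hY : Regular Y)
    {P Q : Fin 3 → Prop} {k : Fin 3 → ℕ} (h : ∀ t, Attains X (P t) (Q t) (k t))
    (hPQ : ∀ t, P t ∨ Q (t + 2)) : dq Y 0 ≤ k 0 + k 1 + k 2 := by
  choose F hF hc hp hq hk using h
  have hD := g.dominatesFilling_union hY F hF hc fun t => (hPQ t).imp (hp t) (hq (t + 2))
  obtain ⟨h1, h2, h3⟩ := (dominatesFilling_iff _ _).1 hD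
  rw [← hk 0, ← hk 1, ← hk 2, ← g.card_union hX hY F fun t => (hF t).1]
  exact minAdm_le h1 h2 h3

/-- The possible shapes of the restriction of a set to a copy, recorded by the filled ones among
the first two hubs and a bound for the size. -/
theorem Gluing.restriction_shape {X Y : GraphGen} (g : Gluing X Y) (hX : Regular X)
    (hT : HasTips X) (F : Fin 3 → Finset (Sym2 X.V))
    (hF : ∀ t, F t ⊆ X.edges) (hD : DominatesFilling Y (g.union F)) (t : Fin 3) :
    dq X 0 ≤ (F t).card ∨ cq X 0 ≤ (F t).card ∨
      (cq X 1 ≤ (F t).card ∧ ¬ (FilledHub X (F t) 0 ∧ FilledHub X (F t) 1)) ∨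
      (bq X 2 ≤ (F t).card ∧ ¬ FilledHub X (F t) 0 ∧ ¬ FilledHub X (F t) 1) := by
  have hlocal : ∀ v, Covered (g.union F) (g.copy t v) →
      Covered (F t) v ∨ v = X.hubs 0 ∨ v = X.hubs 1 := by
    intro v hv
    obtain ⟨s, w, hw, h⟩ := (g.covered_union F _).1 hv
    by_cases hst : s = t
    · subst hst
      exact Or.inl (g.inj s h ▸ hw)
    · exact Or.inr (g.meet t s v w h.symm (Ne.symm hst))
  have hdom : ∀ d ∈ X.edges, Dominated X (F t) d ∨ X.hubs 0 ∈ d ∨ X.hubs 1 ∈ d := by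
    intro d hd
    obtain ⟨v, hv, hc⟩ := (dominated_iff _ _ _).1 (hD.2.1 _ (g.preserves t d hd))
    obtain ⟨w, hw, rfl⟩ := Sym2.mem_map.1 hv
    rcases hlocal w hc with h | rfl | rfl
    · exact Or.inl ((dominated_iff _ _ _).2 ⟨w, hw, h⟩)
    · exact Or.inr (Or.inl hw)
    · exact Or.inr (Or.inr hw)
  have hadm : Admissible X (F t) := by
    refine ⟨hF t, fun d hd hn => ?_⟩
    have cross : ∀ i, X.hubs i ∈ d → CrossHub X (F t) i := fun i hi =>
      ⟨fun hf => hn ((dominated_iff _ _ _).2 ⟨_, hi, hf⟩), d, hd, hi, hn⟩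
    rcases hdom d hd with h | h | h
    · exact absurd h hn
    · exact ⟨0, cross 0 h, h⟩
    · exact ⟨1, cross 1 h, h⟩
  have htip : ¬ FilledHub X (F t) 2 → ∀ i, i ≠ 2 → FilledHub X (F t) i := by
    intro h2 i hi
    obtain ⟨p, hp, hpe, hpn⟩ := hT.tip 2 i (Ne.symm hi)
    have hpc : Covered (F t) p := by
      obtain ⟨v, hv, hc⟩ := (dominated_iff _ _ _).1 (hD.2.1 _ (g.preserves t _ hpe))
      obtain ⟨w, hw, rfl⟩ := Sym2.mem_map.1 hv
      rcases Sym2.mem_iff.1 hw with rfl | rfl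
      · rcases hlocal _ hc with h | h | h
        · exact absurd h h2
        · exact absurd (hX.hubs_inj h) (by decide)
        · exact absurd (hX.hubs_inj h) (by decide)
      · rcases hlocal _ hc with h | h | h
        · exact h
        · exact absurd h (hp _)
        · exact absurd h (hp _)
    obtain ⟨d, hd, hpd⟩ := hpc
    rcases hpn d (hF t hd) hpd with h | h
    · exact absurd ⟨d, hd, h⟩ h2
    · exact ⟨d, hd, h⟩
  by_cases h2 : FilledHub X (F t) 2
  swap
  · have h0 := htip h2 0 (by decide)
    have h1 := htip h2 1 (by decide)
    refine Or.inr (Or.inl (minAdm_le hadm ?_ ?_))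
    · refine card_filter_fin_three_eq_two.2 ⟨2, fun j => ?_⟩
      fin_cases j <;> simp [h0, h1, h2]
    · refine card_filter_fin_three_eq_zero.2 fun i => ?_
      rintro ⟨-, d, hd, -, hn⟩
      rcases hdom d hd with h | h | h
      · exact hn h
      · exact hn ((dominated_iff _ _ _).2 ⟨_, h, h0⟩)
      · exact hn ((dominated_iff _ _ _).2 ⟨_, h, h1⟩)
  have two : ∀ i, (∀ j, FilledHub X (F t) j ↔ j ≠ i) →
      cq X 0 ≤ (F t).card ∨ cq X 1 ≤ (F t).card := by
    intro i hi
    have hfill := card_filter_fin_three_eq_two.2 ⟨i, hi⟩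
    have hne : ∀ j, CrossHub X (F t) j → j = i := fun j hj => by
      by_contra hji
      exact hj.1 ((hi j).2 hji)
    by_cases hx : CrossHub X (F t) i
    · exact Or.inr (minAdm_le hadm hfill
        (card_filter_fin_three_eq_one.2 ⟨i, fun j => ⟨hne j, fun h => h ▸ hx⟩⟩))
    · exact Or.inl (minAdm_le hadm hfill
        (card_filter_fin_three_eq_zero.2 fun j hj => hx (hne j hj ▸ hj)))
  by_cases h0 : FilledHub X (F t) 0 <;> by_cases h1 : FilledHub X (F t) 1
  · refine Or.inl (minAdm_le hadm (card_filter_fin_three_eq_three.2 ?_)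
      (card_filter_fin_three_eq_zero.2 ?_)) <;> intro j <;> fin_cases j
    · exact h0
    · exact h1
    · exact h2
    · exact fun h => h.1 h0
    · exact fun h => h.1 h1
    · exact fun h => h.1 h2
  · have := two 1 fun j => by fin_cases j <;> simp [h0, h1, h2]
    tauto
  · have := two 0 fun j => by fin_cases j <;> simp [h0, h1, h2]
    tauto
  · have hfill : ∀ j, FilledHub X (F t) j ↔ j = 2 := fun j => by
      fin_cases j <;> simp [h0, h1, h2]
    exact Or.inr (Or.inr (Or.inr ⟨minAdm_le hadm (card_filter_fin_three_eq_one.2 ⟨2, hfill⟩)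
      (numCross_of_forall_filledHub_iff hX hfill), h0, h1⟩))

theorem Gluing.exists_union_eq {X Y : GraphGen} (g : Gluing X Y) {F : Finset (Sym2 Y.V)}
    (hF : F ⊆ Y.edges) :
    ∃ F' : Fin 3 → Finset (Sym2 X.V), (∀ t, F' t ⊆ X.edges) ∧ g.union F' = F := by
  refine ⟨fun t => X.edges.filter fun d => Sym2.map (g.copy t) d ∈ F,
    fun t => Finset.filter_subset _ _, ?_⟩
  ext e
  rw [g.mem_union]
  constructor
  · rintro ⟨t, d, hd, rfl⟩
    exact (Finset.mem_filter.1 hd).2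
  · intro he
    obtain ⟨t, d, hd, rfl⟩ := g.cover e (hF he)
    exact ⟨t, d, Finset.mem_filter.2 ⟨hd, he⟩, rfl⟩

/-- the recursion for `d_{n+1}^0` in the pseudofractal scale-free web. -/
theorem pfw_d0_recursion (n : ℕ) (hn : 3 ≤ n) :
    dq (pfw (n + 1)) 0 =
      min (3 * cq (pfw n) 0)
      (min (2 * cq (pfw n) 0 + dq (pfw n) 0)
      (min (2 * cq (pfw n) 0 + bq (pfw n) 2)
      (min (2 * cq (pfw n) 0 + cq (pfw n) 1)
      (min (3 * cq (pfw n) 1)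
      (min (cq (pfw n) 0 + 2 * dq (pfw n) 0)
      (min (cq (pfw n) 0 + 2 * cq (pfw n) 1)
      (min (cq (pfw n) 0 + dq (pfw n) 0 + cq (pfw n) 1)
      (min (2 * dq (pfw n) 0 + cq (pfw n) 1)
      (min (cq (pfw n) 0 + cq (pfw n) 1 + bq (pfw n) 2)
      (min (3 * dq (pfw n) 0)
      (min (2 * dq (pfw n) 0 + bq (pfw n) 2)
      (min (cq (pfw n) 0 + dq (pfw n) 0 + bq (pfw n) 2)
      (min (dq (pfw n) 0 + bq (pfw n) 2 + cq (pfw n) 1)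
      (dq (pfw n) 0 + 2 * cq (pfw n) 1)))))))))))))) := by
  have hX := pfw_regular (n := n) (by omega)
  have hY := pfw_regular (n := n + 1) (by omega)
  have hT := pfw_hasTips (n := n) (by omega)
  have hS := pfw_hubSymmetric (n := n) (by omega)
  obtain ⟨g⟩ := pfw_gluing (n := n) (by omega)
  apply le_antisymm
  · have glue : ∀ {P₀ P₁ P₂ Q₀ Q₁ Q₂ : Prop} {k₀ k₁ k₂ : ℕ}, Attains (pfw n) P₀ Q₀ k₀ →
        Attains (pfw n) P₁ Q₁ k₁ → Attains (pfw n) P₂ Q₂ k₂ → P₀ ∨ Q₂ → P₁ ∨ Q₀ → P₂ ∨ Q₁ →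
        dq (pfw (n + 1)) 0 ≤ k₀ + k₁ + k₂ := by
      intro P₀ P₁ P₂ Q₀ Q₁ Q₂ k₀ k₁ k₂ h₀ h₁ h₂ i₀ i₁ i₂
      refine g.dq_le hX hY (P := ![P₀, P₁, P₂]) (Q := ![Q₀, Q₁, Q₂]) (k := ![k₀, k₁, k₂]) ?_ ?_
      · intro t
        fin_cases t
        exacts [h₀, h₁, h₂]
      · intro t
        fin_cases t
        exacts [i₀, i₁, i₂]
    have hd := attains_dq hX
    have hc := attains_cq_zero hX hT hS
    obtain ⟨hl, hr⟩ := attains_cq_one hX hT hS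
    have hb := attains_bq hX hT hS
    have tl : ∀ {R : Prop}, True ∨ R := Or.inl trivial
    have tr : ∀ {R : Prop}, R ∨ True := Or.inr trivial
    have ccc := glue hc hc hc tl tl tl
    have ccd := glue hc hc hd tl tl tl
    have ccb := glue hc hc hb tl tl tr
    have ccl := glue hc hc hl tl tl tl
    have lll := glue hl hl hl tl tl tl
    have cdd := glue hc hd hd tl tl tl
    have cll := glue hc hl hl tl tl tl
    have cdl := glue hc hd hl tl tl tl
    have ddl := glue hd hd hl tl tl tl
    have crb := glue hc hr hb tl tr tr
    have ddd := glue hd hd hd tl tl tl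
    have ddb := glue hd hd hb tl tl tr
    have cdb := glue hc hd hb tl tl tr
    have drb := glue hd hr hb tl tr tr
    have dll := glue hd hl hl tl tl tl
    simp only [le_min_iff]
    omega
  · obtain ⟨F, h1, h2, h3, hk⟩ := exists_card_eq_minAdm
      ⟨_, (dominatesFilling_iff (pfw (n + 1)) _).1 hY.dominatesFilling_edges⟩
    have hD := (dominatesFilling_iff _ _).2 ⟨h1, h2, h3⟩
    obtain ⟨F, hF, rfl⟩ := g.exists_union_eq hD.1
    have hf := fun t => (g.filledHub_union hY F t).1 (hD.2.2 t)
    have f0 : FilledHub _ (F 0) 0 ∨ FilledHub _ (F 2) 1 := hf 0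
    have f1 : FilledHub _ (F 1) 0 ∨ FilledHub _ (F 0) 1 := hf 1
    have f2 : FilledHub _ (F 2) 0 ∨ FilledHub _ (F 1) 1 := hf 2
    have s0 := g.restriction_shape hX hT F hF hD 0
    have s1 := g.restriction_shape hX hT F hF hD 1
    have s2 := g.restriction_shape hX hT F hF hD 2
    change _ ≤ minAdm (pfw (n + 1)) 3 0
    rw [← hk, g.card_union hX hY F hF]
    simp only [min_le_iff]
    rcases s0 with s0 | s0 | ⟨s0, n0⟩ | ⟨s0, n0⟩ <;>
      rcases s1 with s1 | s1 | ⟨s1, n1⟩ | ⟨s1, n1⟩ <;>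
      rcases s2 with s2 | s2 | ⟨s2, n2⟩ | ⟨s2, n2⟩ <;>
      first | omega | (exfalso; tauto)
end

section
/- For every n ≥ 3, the quantities for consecutive generations of the pseudofractal scale-free web satisfy b_{n+1}^2 = min{2c_n^0 + b_n^2, c_n^0 + b_n^2 + c_n^1, 2b_n^2 + c_n^1, b_n^2 + 2c_n^1}. -/
/-!
Common definitions: the pseudofractal scale-free web `pfw n` (= `G_n` for `n ≥ 1`)
and the Sierpinski graph `sierp n` (= `S_n` for `n ≥ 1`), together with the
edge-domination notions used in the paper.
-/

open scoped Classical

/-- A generation with distinct hubs, without isolated vertices and without loops. -/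
structure GraphGen.IsProper (X : GraphGen) : Prop where
  hubs_injective : Function.Injective X.hubs
  exists_edge : ∀ v, ∃ e ∈ X.edges, v ∈ e
  not_isDiag : ∀ e ∈ X.edges, ¬ e.IsDiag

/-- The vertices of `S` can be assigned pairwise distinct incident edges. -/
def HasIncidentEdges (X : GraphGen) (S : Set X.V) : Prop :=
  ∃ φ : X.V → Sym2 X.V, (∀ v ∈ S, φ v ∈ X.edges ∧ v ∈ φ v) ∧ Set.InjOn φ S

/-- The vertices other than the hubs with index outside `H`. -/
def nonHubsExcept (X : GraphGen) (H : Finset (Fin 3)) : Set X.V :=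
  {v | ∀ i, X.hubs i = v → i ∈ H}

section Step

variable {X : GraphGen}

lemma mem_edges_pfwStep {f : Sym2 (X.V ⊕ {e : Sym2 X.V // e ∈ X.edges})} :
    f ∈ (pfwStep X).edges ↔ (∃ e ∈ X.edges, Sym2.map Sum.inl e = f) ∨
      ∃ e : {e : Sym2 X.V // e ∈ X.edges}, ∃ v ∈ e.1,
        s((Sum.inl v : X.V ⊕ {e : Sym2 X.V // e ∈ X.edges}), Sum.inr e) = f := by
  refine Finset.mem_union.trans (or_congr Finset.mem_image (Finset.mem_biUnion.trans ?_))
  simp only [Finset.mem_image, Finset.mem_attach, Finset.mem_filter, Finset.mem_univ, true_and]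

lemma mk_mem_edges_pfwStep (e : {e : Sym2 X.V // e ∈ X.edges}) {v : X.V} (hv : v ∈ e.1) :
    s((Sum.inl v : X.V ⊕ {e : Sym2 X.V // e ∈ X.edges}), Sum.inr e) ∈ (pfwStep X).edges :=
  mem_edges_pfwStep.2 (Or.inr ⟨e, v, hv, rfl⟩)

lemma map_mem_edges_pfwStep {e : Sym2 X.V} (he : e ∈ X.edges) :
    (Sym2.map Sum.inl e : Sym2 (X.V ⊕ {e : Sym2 X.V // e ∈ X.edges})) ∈ (pfwStep X).edges :=
  mem_edges_pfwStep.2 (Or.inl ⟨e, he, rfl⟩)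

lemma eq_of_inr_mem_edge {f : Sym2 (X.V ⊕ {e : Sym2 X.V // e ∈ X.edges})}
    (hf : f ∈ (pfwStep X).edges) {a b : {e : Sym2 X.V // e ∈ X.edges}}
    (ha : Sum.inr a ∈ f) (hb : Sum.inr b ∈ f) : a = b := by
  rcases mem_edges_pfwStep.1 hf with ⟨e, -, rfl⟩ | ⟨e, v, hv, rfl⟩
  · simp [Sym2.mem_map] at ha
  · simp [Sym2.mem_iff] at ha hb
    rw [ha, hb]

lemma mem_of_inl_mem_edge {f : Sym2 (X.V ⊕ {e : Sym2 X.V // e ∈ X.edges})}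
    (hf : f ∈ (pfwStep X).edges) {a : {e : Sym2 X.V // e ∈ X.edges}} {v : X.V}
    (ha : Sum.inr a ∈ f) (hv : Sum.inl v ∈ f) : v ∈ a.1 := by
  rcases mem_edges_pfwStep.1 hf with ⟨e, -, rfl⟩ | ⟨e, u, hu, rfl⟩
  · simp [Sym2.mem_map] at ha
  · simp [Sym2.mem_iff] at ha hv
    rwa [ha, hv]

lemma exists_edge_of_inl_mem_edge {f : Sym2 (X.V ⊕ {e : Sym2 X.V // e ∈ X.edges})}
    (hf : f ∈ (pfwStep X).edges) {u v : X.V} (huv : u ≠ v)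
    (hu : Sum.inl u ∈ f) (hv : Sum.inl v ∈ f) : ∃ e ∈ X.edges, u ∈ e ∧ v ∈ e := by
  rcases mem_edges_pfwStep.1 hf with ⟨e, he, rfl⟩ | ⟨e, w, hw, rfl⟩
  · simp [Sym2.mem_map] at hu hv
    exact ⟨e, he, hu, hv⟩
  · simp [Sym2.mem_iff] at hu hv
    exact absurd (hu.trans hv.symm) huv

lemma exists_inl_mem_edge {f : Sym2 (X.V ⊕ {e : Sym2 X.V // e ∈ X.edges})}
    (hf : f ∈ (pfwStep X).edges) : ∃ v : X.V, Sum.inl v ∈ f := by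
  rcases mem_edges_pfwStep.1 hf with ⟨e, he, rfl⟩ | ⟨e, w, hw, rfl⟩
  · exact ⟨e.out.1, Sym2.mem_map.2 ⟨_, e.out_fst_mem, rfl⟩⟩
  · exact ⟨w, Sym2.mem_mk_left _ _⟩

lemma GraphGen.IsProper.pfwStep (hX : X.IsProper) : (pfwStep X).IsProper where
  hubs_injective := Sum.inl_injective.comp hX.hubs_injective
  exists_edge := by
    rintro (v | e)
    · obtain ⟨e, he, hv⟩ := hX.exists_edge v
      exact ⟨_, map_mem_edges_pfwStep he, Sym2.mem_map.2 ⟨v, hv, rfl⟩⟩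
    · exact ⟨_, mk_mem_edges_pfwStep e (Sym2.out_fst_mem _), Sym2.mem_mk_right _ _⟩
  not_isDiag := by
    intro f hf
    rcases mem_edges_pfwStep.1 hf with ⟨e, he, rfl⟩ | ⟨e, w, hw, rfl⟩
    · exact fun h => hX.not_isDiag e he ((Sym2.isDiag_map Sum.inl_injective).1 h)
    · exact fun h => Sum.inl_ne_inr (Sym2.mk_isDiag_iff.1 h)

lemma card_edges_pfwStep (hX : X.IsProper) :
    (pfwStep X).edges.card = 3 * X.edges.card := by
  have h1 : (X.edges.image (Sym2.map
      (Sum.inl : X.V → X.V ⊕ {e : Sym2 X.V // e ∈ X.edges}))).card = X.edges.card :=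
    Finset.card_image_of_injective _ (Sym2.map.injective Sum.inl_injective)
  have h2 : (X.edges.attach.biUnion fun e =>
        (Finset.univ.filter fun v : X.V => v ∈ (e : Sym2 X.V)).image fun v =>
          s((Sum.inl v : X.V ⊕ {e : Sym2 X.V // e ∈ X.edges}), Sum.inr e)).card
      = 2 * X.edges.card := by
    rw [Finset.card_biUnion]
    · rw [Finset.sum_congr rfl (g := fun _ => 2)]
      · simp [mul_comm]
      · rintro ⟨e, he⟩ -
        rw [Finset.card_image_of_injective]
        · have := hX.not_isDiag e he
          induction e with | _ a b =>
          have hab : a ≠ b := by simpa using this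
          rw [← Finset.card_pair hab]
          congr 1
          ext v
          simp
        · intro u v h
          simpa using h
    · intro a _ b _ hab
      refine Finset.disjoint_left.2 fun f hf hf' => ?_
      simp only [Finset.mem_image, Finset.mem_filter, Finset.mem_univ, true_and] at hf hf'
      obtain ⟨u, -, rfl⟩ := hf
      obtain ⟨v, -, h⟩ := hf'
      simp at h
      exact hab h.2.symm
  have h3 : Disjoint (X.edges.image (Sym2.map
      (Sum.inl : X.V → X.V ⊕ {e : Sym2 X.V // e ∈ X.edges})))
      (X.edges.attach.biUnion fun e =>
        (Finset.univ.filter fun v : X.V => v ∈ (e : Sym2 X.V)).image fun v =>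
          s((Sum.inl v : X.V ⊕ {e : Sym2 X.V // e ∈ X.edges}), Sum.inr e)) := by
    refine Finset.disjoint_left.2 fun f hf hf' => ?_
    simp only [Finset.mem_image, Finset.mem_biUnion] at hf hf'
    obtain ⟨e, -, rfl⟩ := hf
    obtain ⟨a, -, v, -, h⟩ := hf'
    have : (Sum.inr a : X.V ⊕ {e : Sym2 X.V // e ∈ X.edges}) ∈ Sym2.map Sum.inl e := by
      rw [← h]; exact Sym2.mem_mk_right _ _
    simp [Sym2.mem_map] at this
  refine (Finset.card_union_of_disjoint h3).trans ?_
  rw [h1, h2]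
  ring

lemma HasIncidentEdges.pfwStep {H : Finset (Fin 3)}
    (h : HasIncidentEdges X (nonHubsExcept X H)) :
    HasIncidentEdges (pfwStep X) (nonHubsExcept (pfwStep X) H) := by
  obtain ⟨φ, hφ, hinj⟩ := h
  have hS : ∀ v : X.V, (Sum.inl v : X.V ⊕ {e : Sym2 X.V // e ∈ X.edges}) ∈
      nonHubsExcept (_root_.pfwStep X) H → v ∈ nonHubsExcept X H := by
    intro v hv i hi
    exact hv i (congrArg Sum.inl hi)
  refine ⟨fun v : X.V ⊕ {e : Sym2 X.V // e ∈ X.edges} => Sum.elim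
    (fun v => Sym2.map Sum.inl (φ v)) (fun e => s(Sum.inl e.1.out.1, Sum.inr e)) v, ?_, ?_⟩
  · rintro (v | e) hv
    · obtain ⟨h1, h2⟩ := hφ v (hS v hv)
      exact ⟨map_mem_edges_pfwStep h1, Sym2.mem_map.2 ⟨v, h2, rfl⟩⟩
    · exact ⟨mk_mem_edges_pfwStep e (Sym2.out_fst_mem _), Sym2.mem_mk_right _ _⟩
  · have hne : ∀ (a : Sym2 X.V) (e : {e : Sym2 X.V // e ∈ X.edges}) (u : X.V),
        Sym2.map Sum.inl a ≠ s(Sum.inl u, Sum.inr e) := by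
      intro a e u h
      have : (Sum.inr e : X.V ⊕ {e : Sym2 X.V // e ∈ X.edges}) ∈ Sym2.map Sum.inl a := by
        rw [h]; exact Sym2.mem_mk_right _ _
      simp [Sym2.mem_map] at this
    rintro (u | e) hu (v | e') hv huv
    · exact congrArg Sum.inl
        (hinj (hS u hu) (hS v hv) (Sym2.map.injective Sum.inl_injective huv))
    · exact absurd huv (hne _ _ _)
    · exact absurd huv.symm (hne _ _ _)
    · have huv' : s((Sum.inl e.1.out.1 : X.V ⊕ {e : Sym2 X.V // e ∈ X.edges}), Sum.inr e) =
          s(Sum.inl e'.1.out.1, Sum.inr e') := huv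
      have h := huv' ▸ Sym2.mem_mk_right (Sum.inl e.1.out.1) (Sum.inr e)
      rcases Sym2.mem_iff.1 h with h | h
      · exact absurd h Sum.inr_ne_inl
      · exact h

lemma exists_edge_notMem_pfwStep (hX : X.IsProper) {u v : (pfwStep X).V} (w : X.V)
    (hu : u = Sum.inl w) (hvu : v ≠ u) : ∃ e ∈ (pfwStep X).edges, v ∈ e ∧ u ∉ e := by
  subst hu
  rcases v with v | e
  · obtain ⟨e, he, hv⟩ := hX.exists_edge v
    refine ⟨_, mk_mem_edges_pfwStep ⟨e, he⟩ hv, Sym2.mem_mk_left _ _, ?_⟩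
    intro h
    rcases Sym2.mem_iff.1 h with h | h
    · exact hvu h.symm
    · exact Sum.inl_ne_inr h
  · obtain ⟨x, hx, hxw⟩ : ∃ x ∈ e.1, x ≠ w := by
      obtain ⟨e, he⟩ := e
      have := hX.not_isDiag e he
      induction e with | _ a b =>
      have hab : a ≠ b := by simpa using this
      by_cases h : a = w
      · exact ⟨b, Sym2.mem_mk_right _ _, fun hb => hab (h.trans hb.symm)⟩
      · exact ⟨a, Sym2.mem_mk_left _ _, h⟩
    refine ⟨_, mk_mem_edges_pfwStep e hx, Sym2.mem_mk_right _ _, ?_⟩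
    intro h
    rcases Sym2.mem_iff.1 h with h | h
    · exact hxw (Sum.inl_injective h).symm
    · exact Sum.inl_ne_inr h

/-- The edges avoiding one hub form an admissible set with two filled and no cross hubs. -/
lemma exists_admissible_two_zero (hX : X.IsProper) :
    ∃ F, Admissible (pfwStep X) F ∧ numFilled (pfwStep X) F = 2 ∧
      numCross (pfwStep X) F = 0 := by
  have hY := hX.pfwStep
  set F := (pfwStep X).edges.filter fun e => (pfwStep X).hubs 2 ∉ e with hF
  have hcover : ∀ v, v ≠ (pfwStep X).hubs 2 → ∃ f ∈ F, v ∈ f := by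
    intro v hv
    obtain ⟨e, he, h1, h2⟩ := exists_edge_notMem_pfwStep hX (X.hubs 2) rfl hv
    exact ⟨e, Finset.mem_filter.2 ⟨he, h2⟩, h1⟩
  have hdom : ∀ e ∈ (pfwStep X).edges, Dominated (pfwStep X) F e := by
    intro e he
    have hd := hY.not_isDiag e he
    obtain ⟨v, hve, hv⟩ : ∃ v ∈ e, v ≠ (pfwStep X).hubs 2 := by
      induction e with | _ a b =>
      have hab : a ≠ b := by simpa using hd
      by_cases h : a = (pfwStep X).hubs 2
      · exact ⟨b, Sym2.mem_mk_right _ _, fun hb => hab (h.trans hb.symm)⟩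
      · exact ⟨a, Sym2.mem_mk_left _ _, h⟩
    obtain ⟨f, hf, hvf⟩ := hcover v hv
    exact Or.inr ⟨f, hf, v, hve, hvf⟩
  have hfill : ∀ i, FilledHub (pfwStep X) F i ↔ i ∈ ({0, 1} : Finset (Fin 3)) := by
    intro i
    have h2 : i ∈ ({0, 1} : Finset (Fin 3)) ↔ i ≠ 2 := by fin_cases i <;> decide
    rw [h2]
    constructor
    · rintro ⟨f, hf, hif⟩ rfl
      exact (Finset.mem_filter.1 hf).2 hif
    · intro hi
      exact hcover _ (hY.hubs_injective.ne hi)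
  refine ⟨F, ⟨Finset.filter_subset _ _, fun e he h => absurd (hdom e he) h⟩, ?_, ?_⟩
  · simp only [numFilled, hfill, Finset.filter_univ_mem]
    rfl
  · rw [numCross, Finset.card_eq_zero, Finset.filter_eq_empty_iff]
    rintro i - ⟨-, e, he, -, h⟩
    exact h (hdom e he)

/-- Each edge of `X` forces its own edge in an admissible set two generations later. -/
lemma card_edges_le_of_admissible {F : Finset (Sym2 (pfwStep (pfwStep X)).V)}
    (hF : Admissible (pfwStep (pfwStep X)) F) : X.edges.card ≤ F.card := by
  let R : {e : Sym2 X.V // e ∈ X.edges} → Sym2 (pfwStep (pfwStep X)).V → Prop := fun e f =>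
    Sum.inl (Sum.inr e) ∈ f ∨
      ∃ a : {a : Sym2 (pfwStep X).V // a ∈ (pfwStep X).edges}, Sum.inr a ∈ f ∧ Sum.inr e ∈ a.1
  have hex : ∀ e ∈ X.edges.attach, ∃ f, f ∈ F ∧ R e f := by
    intro e _
    let a : {a : Sym2 (pfwStep X).V // a ∈ (pfwStep X).edges} :=
      ⟨_, mk_mem_edges_pfwStep e (Sym2.out_fst_mem _)⟩
    have ha : Sum.inr e ∈ a.1 := Sym2.mem_mk_right _ _
    have hg := mk_mem_edges_pfwStep a ha
    by_cases hd : Dominated (pfwStep (pfwStep X)) F s(Sum.inl (Sum.inr e), Sum.inr a)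
    · rcases hd with hd | ⟨f, hf, v, hv, hvf⟩
      · exact ⟨_, hd, Or.inl (Sym2.mem_mk_left _ _)⟩
      · refine ⟨f, hf, ?_⟩
        rcases Sym2.mem_iff.1 hv with rfl | rfl
        · exact Or.inl hvf
        · exact Or.inr ⟨a, hvf, ha⟩
    · obtain ⟨i, -, hi⟩ := hF.2 _ hg hd
      rcases Sym2.mem_iff.1 hi with h | h
      · exact absurd (Sum.inl_injective h) Sum.inl_ne_inr
      · exact absurd h Sum.inl_ne_inr
  have huniq : ∀ f ∈ F, ∀ e e', R e f → R e' f → e = e' := by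
    intro f hf e e' h h'
    have hfE := hF.1 hf
    rcases h with h | ⟨a, haf, hea⟩ <;> rcases h' with h' | ⟨b, hbf, heb⟩
    · by_contra hne
      obtain ⟨g, hg, h1, h2⟩ := exists_edge_of_inl_mem_edge hfE
        (fun heq => hne (Sum.inr_injective heq)) h h'
      exact hne (eq_of_inr_mem_edge hg h1 h2)
    · exact eq_of_inr_mem_edge b.2 (mem_of_inl_mem_edge hfE hbf h) heb
    · exact eq_of_inr_mem_edge a.2 hea (mem_of_inl_mem_edge hfE haf h')
    · obtain rfl := eq_of_inr_mem_edge hfE haf hbf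
      exact eq_of_inr_mem_edge a.2 hea heb
  rw [← Finset.card_attach]
  refine Finset.card_le_card_of_forall_subsingleton R hex ?_
  rintro f hf e ⟨-, he⟩ e' ⟨-, he'⟩
  exact huniq f hf e e' he he'

/-- Two generations later, every edge of `X` contributes one edge at the vertex it created, and the
old vertices filled in this way can be prescribed to be those outside some of the hubs. -/
lemma exists_admissible_card_le (hX : X.IsProper) {H : Finset (Fin 3)}
    (h : HasIncidentEdges X (nonHubsExcept X H)) :
    ∃ F, Admissible (pfwStep (pfwStep X)) F ∧ numFilled (pfwStep (pfwStep X)) F = H.card ∧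
      numCross (pfwStep (pfwStep X)) F = Hᶜ.card ∧ F.card ≤ X.edges.card := by
  obtain ⟨φ, hφ, hinj⟩ := h
  have key : ∀ e : {e : Sym2 X.V // e ∈ X.edges}, ∃ f ∈ (pfwStep (pfwStep X)).edges,
      Sum.inl (Sum.inr e) ∈ f ∧
      (∀ v, Sum.inl (Sum.inl v) ∈ f ↔ v ∈ nonHubsExcept X H ∧ φ v = e.1) ∧
      ∀ (a : Sym2 X.V) (ha : a ∈ X.edges), Sum.inr ⟨_, map_mem_edges_pfwStep ha⟩ ∉ f := by
    intro e
    by_cases hv : ∃ v ∈ nonHubsExcept X H, φ v = e.1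
    · obtain ⟨v, hvS, hve⟩ := hv
      have hv' : v ∈ e.1 := hve ▸ (hφ v hvS).2
      refine ⟨_, map_mem_edges_pfwStep (mk_mem_edges_pfwStep e hv'), ?_, ?_, ?_⟩
      · exact Sym2.mem_map.2 ⟨_, Sym2.mem_mk_right _ _, rfl⟩
      · intro u
        constructor
        · intro hu
          obtain ⟨y, hy, hyu⟩ := Sym2.mem_map.1 hu
          obtain rfl := Sum.inl_injective hyu
          rcases Sym2.mem_iff.1 hy with h | h
          · obtain rfl := Sum.inl_injective h
            exact ⟨hvS, hve⟩
          · exact absurd h Sum.inl_ne_inr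
        · rintro ⟨huS, hue⟩
          obtain rfl := hinj huS hvS (hue.trans hve.symm)
          exact Sym2.mem_map.2 ⟨_, Sym2.mem_mk_left _ _, rfl⟩
      · intro a ha hmem
        obtain ⟨y, hy, hyu⟩ := Sym2.mem_map.1 hmem
        exact Sum.inl_ne_inr hyu
    · let a : {a : Sym2 (pfwStep X).V // a ∈ (pfwStep X).edges} :=
        ⟨_, mk_mem_edges_pfwStep e (Sym2.out_fst_mem _)⟩
      have ha : Sum.inr e ∈ a.1 := Sym2.mem_mk_right _ _
      refine ⟨_, mk_mem_edges_pfwStep a ha, Sym2.mem_mk_left _ _, ?_, ?_⟩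
      · intro u
        constructor
        · intro hu
          rcases Sym2.mem_iff.1 hu with h | h
          · exact absurd (Sum.inl_injective h) Sum.inl_ne_inr
          · exact absurd h Sum.inl_ne_inr
        · exact fun hu => absurd ⟨u, hu⟩ hv
      · intro b hb hmem
        rcases Sym2.mem_iff.1 hmem with h | h
        · exact Sum.inr_ne_inl h
        · have h' : a.1 = Sym2.map Sum.inl b := (congrArg Subtype.val (Sum.inr_injective h)).symm
          have h'' : (Sum.inr e : X.V ⊕ {e : Sym2 X.V // e ∈ X.edges}) ∈ Sym2.map Sum.inl b :=
            h' ▸ ha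
          obtain ⟨y, hy, hyu⟩ := Sym2.mem_map.1 h''
          exact Sum.inl_ne_inr hyu
  choose f hfE hfx hfv hfa using key
  set F : Finset (Sym2 (pfwStep (pfwStep X)).V) := X.edges.attach.image f with hF
  have hmem : ∀ g, g ∈ F ↔ ∃ e, f e = g := by simp [hF]
  have hfill : ∀ i, FilledHub (pfwStep (pfwStep X)) F i ↔ i ∈ H := by
    intro i
    constructor
    · rintro ⟨g, hg, hi⟩
      obtain ⟨e, rfl⟩ := (hmem g).1 hg
      exact ((hfv e (X.hubs i)).1 hi).1 i rfl
    · intro hi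
      have hS : X.hubs i ∈ nonHubsExcept X H := fun j hj => hX.hubs_injective hj ▸ hi
      exact ⟨_, (hmem _).2 ⟨⟨_, (hφ _ hS).1⟩, rfl⟩, (hfv _ _).2 ⟨hS, rfl⟩⟩
  have hcross : ∀ i, CrossHub (pfwStep (pfwStep X)) F i ↔ i ∈ Hᶜ := by
    intro i
    rw [Finset.mem_compl, ← hfill]
    refine ⟨fun h => h.1, fun hi => ⟨hi, ?_⟩⟩
    obtain ⟨e, he, hie⟩ := hX.exists_edge (X.hubs i)
    let a : {a : Sym2 (pfwStep X).V // a ∈ (pfwStep X).edges} := ⟨_, map_mem_edges_pfwStep he⟩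
    have ha : Sum.inl (X.hubs i) ∈ a.1 := Sym2.mem_map.2 ⟨_, hie, rfl⟩
    refine ⟨_, mk_mem_edges_pfwStep a ha, Sym2.mem_mk_left _ _, ?_⟩
    have hno : ¬ ∃ g ∈ F, ∃ v, v ∈ s((Sum.inl (Sum.inl (X.hubs i)) :
        (pfwStep X).V ⊕ {a : Sym2 (pfwStep X).V // a ∈ (pfwStep X).edges}), Sum.inr a) ∧
        v ∈ g := by
      rintro ⟨g, hg, v, hv, hvg⟩
      rcases Sym2.mem_iff.1 hv with rfl | rfl
      · exact hi ⟨g, hg, hvg⟩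
      · obtain ⟨e', rfl⟩ := (hmem g).1 hg
        exact hfa e' e he hvg
    rintro (hd | hd)
    · exact hno ⟨_, hd, _, Sym2.mem_mk_left _ _, Sym2.mem_mk_left _ _⟩
    · exact hno hd
  refine ⟨F, ⟨?_, ?_⟩, ?_, ?_, ?_⟩
  · intro g hg
    obtain ⟨e, rfl⟩ := (hmem g).1 hg
    exact hfE e
  · intro g hg hd
    obtain ⟨y, hy⟩ := exists_inl_mem_edge hg
    rcases y with v | e
    · by_cases hv : v ∈ nonHubsExcept X H
      · exact absurd (Or.inr ⟨_, (hmem _).2 ⟨⟨_, (hφ _ hv).1⟩, rfl⟩, _, hy,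
          (hfv _ _).2 ⟨hv, rfl⟩⟩) hd
      · obtain ⟨i, hi'⟩ := not_forall.1 hv
        obtain ⟨rfl, hi⟩ := Classical.not_imp.1 hi'
        exact ⟨i, (hcross i).2 (Finset.mem_compl.2 hi), hy⟩
    · exact absurd (Or.inr ⟨_, (hmem _).2 ⟨e, rfl⟩, _, hy, hfx e⟩) hd
  · simp only [numFilled, hfill, Finset.filter_univ_mem]
  · simp only [numCross, hcross, Finset.filter_univ_mem]
  · exact Finset.card_image_le.trans Finset.card_attach.le

lemma card_edges_le_minAdm {k l : ℕ}
    (h : ∃ F, Admissible (pfwStep (pfwStep X)) F ∧ numFilled (pfwStep (pfwStep X)) F = k ∧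
      numCross (pfwStep (pfwStep X)) F = l) :
    X.edges.card ≤ minAdm (pfwStep (pfwStep X)) k l := by
  obtain ⟨F, h1, h2, h3⟩ := h
  refine le_csInf ⟨_, F, h1, h2, h3, rfl⟩ ?_
  rintro _ ⟨F, hF, -, -, rfl⟩
  exact card_edges_le_of_admissible hF

lemma minAdm_pfwStep_pfwStep (hX : X.IsProper) {H : Finset (Fin 3)}
    (h : HasIncidentEdges X (nonHubsExcept X H)) :
    minAdm (pfwStep (pfwStep X)) H.card Hᶜ.card = X.edges.card := by
  obtain ⟨F, h1, h2, h3, h4⟩ := exists_admissible_card_le hX h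
  have hle : minAdm (pfwStep (pfwStep X)) H.card Hᶜ.card ≤ F.card :=
    Nat.sInf_le ⟨F, h1, h2, h3, rfl⟩
  exact le_antisymm (hle.trans h4) (card_edges_le_minAdm ⟨F, h1, h2, h3⟩)

end Step

lemma mem_edges_triangle {e : Sym2 (Fin 3)} :
    e ∈ triangle.edges ↔ e = s(0, 1) ∨ e = s(0, 2) ∨ e = s(1, 2) := by
  change e ∈ ({s(0, 1), s(0, 2), s(1, 2)} : Finset (Sym2 (Fin 3))) ↔ _
  simp

lemma isProper_pfw (m : ℕ) : (pfw (m + 1)).IsProper := by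
  induction m with
  | zero =>
    refine ⟨Function.injective_id, ?_, ?_⟩
    · intro v
      have key : ∀ v : Fin 3, ∃ e : Sym2 (Fin 3),
          (e = s(0, 1) ∨ e = s(0, 2) ∨ e = s(1, 2)) ∧ v ∈ e := by decide
      obtain ⟨e, he, hv⟩ := key v
      exact ⟨e, mem_edges_triangle.2 he, hv⟩
    · intro e he
      have key : ∀ e : Sym2 (Fin 3), e = s(0, 1) ∨ e = s(0, 2) ∨ e = s(1, 2) →
          ¬ e.IsDiag := by decide
      exact key e (mem_edges_triangle.1 he)
  | succ m ih => exact ih.pfwStep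

lemma hasIncidentEdges_pfw (m : ℕ) {H : Finset (Fin 3)} (hH : H ⊆ {0, 1}) :
    HasIncidentEdges (pfw (m + 1)) (nonHubsExcept (pfw (m + 1)) H) := by
  induction m with
  | zero =>
    have hS : ∀ v : Fin 3, v ∈ nonHubsExcept triangle H → v = 0 ∨ v = 1 := by
      intro v hv
      simpa using hH (hv v rfl)
    refine ⟨fun v : Fin 3 => (s(v, 2) : Sym2 (Fin 3)), ?_, ?_⟩
    · intro v hv
      refine ⟨mem_edges_triangle.2 ?_, Sym2.mem_mk_left _ _⟩
      rcases hS v hv with rfl | rfl <;> simp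
    · intro u _ v _ huv
      exact Sym2.congr_left.1 huv
  | succ m ih => exact ih.pfwStep

lemma bq_two_pfw (m : ℕ) : bq (pfw (m + 3)) 2 = (pfw (m + 1)).edges.card :=
  minAdm_pfwStep_pfwStep (isProper_pfw m) (hasIncidentEdges_pfw m (H := {0}) (by decide))

lemma cq_one_pfw (m : ℕ) : cq (pfw (m + 3)) 1 = (pfw (m + 1)).edges.card :=
  minAdm_pfwStep_pfwStep (isProper_pfw m) (hasIncidentEdges_pfw m (H := {0, 1}) (by decide))

lemma card_le_cq_zero_pfw (m : ℕ) : (pfw (m + 1)).edges.card ≤ cq (pfw (m + 3)) 0 :=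
  card_edges_le_minAdm (exists_admissible_two_zero (isProper_pfw m).pfwStep)

/-- the recursion for `b_{n+1}^2` in the pseudofractal scale-free web. -/
theorem pfw_b2_recursion (n : ℕ) (hn : 3 ≤ n) :
    bq (pfw (n + 1)) 2 =
      min (2 * cq (pfw n) 0 + bq (pfw n) 2)
      (min (cq (pfw n) 0 + bq (pfw n) 2 + cq (pfw n) 1)
      (min (2 * bq (pfw n) 2 + cq (pfw n) 1)
      (bq (pfw n) 2 + 2 * cq (pfw n) 1))) := by
  obtain ⟨m, rfl⟩ := Nat.exists_eq_add_of_le' hn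
  have hb := bq_two_pfw m
  have hb' := bq_two_pfw (m + 1)
  have hc := cq_one_pfw m
  have hc' := card_le_cq_zero_pfw m
  have hE : (pfw (m + 1 + 1)).edges.card = 3 * (pfw (m + 1)).edges.card :=
    card_edges_pfwStep (isProper_pfw m)
  have : bq (pfw (m + 3 + 1)) 2 = (pfw (m + 1 + 1)).edges.card := hb'
  omega
end

section
/- For every n ≥ 3, the quantities associated with the pseudofractal scale-free web satisfy the simplified recursions b_{n+1}^2 = 2c_n^1 + b_n^2, c_{n+1}^1 = 3c_n^1, d_{n+1}^0 = 3d_n^0, and c_{n+1}^0 = 2c_n^0 + c_n^1. -/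
/-!
Common definitions: the pseudofractal scale-free web `pfw n` (= `G_n` for `n ≥ 1`)
and the Sierpinski graph `sierp n` (= `S_n` for `n ≥ 1`), together with the
edge-domination notions used in the paper.
-/

open scoped Classical

noncomputable section

namespace GraphGen

variable {X : GraphGen}

/-- A vertex of `X`, seen as a vertex of the next generation. -/
def old (v : X.V) : (pfwStep X).V := Sum.inl v

/-- The vertex of the next generation attached to the edge `e` of `X`. -/
def new (e : Sym2 X.V) (he : e ∈ X.edges) : (pfwStep X).V := Sum.inr ⟨e, he⟩

lemma old_injective : Function.Injective (old (X := X)) := Sum.inl_injective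

@[simp] lemma old_inj {u v : X.V} : old u = old v ↔ u = v := old_injective.eq_iff

@[simp] lemma new_inj {e e' : Sym2 X.V} {he : e ∈ X.edges} {he' : e' ∈ X.edges} :
    new e he = new e' he' ↔ e = e' :=
  ⟨fun h => congrArg Subtype.val (Sum.inr_injective h), fun h => by subst h; rfl⟩

@[simp] lemma old_ne_new {v : X.V} {e : Sym2 X.V} {he : e ∈ X.edges} : old v ≠ new e he :=
  Sum.inl_ne_inr

@[simp] lemma new_ne_old {v : X.V} {e : Sym2 X.V} {he : e ∈ X.edges} : new e he ≠ old v :=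
  Sum.inr_ne_inl

lemma eq_old_or_eq_new (x : (pfwStep X).V) : (∃ v, x = old v) ∨ ∃ e he, x = new e he := by
  rcases x with v | ⟨e, he⟩
  exacts [Or.inl ⟨v, rfl⟩, Or.inr ⟨e, he, rfl⟩]

@[simp] lemma hubs_pfwStep (i : Fin 3) : (pfwStep X).hubs i = old (X.hubs i) := rfl

@[simp] lemma old_mem_map {v : X.V} {e : Sym2 X.V} : old v ∈ e.map old ↔ v ∈ e := by
  simp [Sym2.mem_map]

@[simp] lemma new_notMem_map {d e : Sym2 X.V} {hd : d ∈ X.edges} : new d hd ∉ e.map old := by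
  simp [Sym2.mem_map]

/-- `f` is one of the three edges of the next generation arising from the edge `d`. -/
def IsChild (d : Sym2 X.V) (f : Sym2 (pfwStep X).V) : Prop :=
  f = d.map old ∨ ∃ v ∈ d, ∃ hd, f = s(old v, new d hd)

lemma mem_edges_pfwStep {f : Sym2 (pfwStep X).V} :
    f ∈ (pfwStep X).edges ↔ ∃ d ∈ X.edges, IsChild d f := by
  have key : f ∈ (pfwStep X).edges ↔ (∃ d ∈ X.edges, d.map old = f) ∨
      ∃ d hd, ∃ v ∈ d, s(old v, new d hd) = f := by
    refine (Finset.mem_union (α := Sym2 (X.V ⊕ {e // e ∈ X.edges}))).trans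
      (or_congr (Finset.mem_image (β := Sym2 (X.V ⊕ {e // e ∈ X.edges})))
        ((Finset.mem_biUnion (β := Sym2 (X.V ⊕ {e // e ∈ X.edges}))).trans ?_))
    constructor
    · rintro ⟨⟨d, hd⟩, -, h⟩
      obtain ⟨v, hv, rfl⟩ := Finset.mem_image.1 h
      exact ⟨d, hd, v, (Finset.mem_filter.1 hv).2, rfl⟩
    · rintro ⟨d, hd, v, hv, rfl⟩
      exact ⟨⟨d, hd⟩, Finset.mem_attach _ _, Finset.mem_image.2
        ⟨v, Finset.mem_filter.2 ⟨Finset.mem_univ _, hv⟩, rfl⟩⟩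
  rw [key]
  constructor
  · rintro (⟨d, hd, rfl⟩ | ⟨d, hd, v, hv, rfl⟩)
    exacts [⟨d, hd, Or.inl rfl⟩, ⟨d, hd, Or.inr ⟨v, hv, hd, rfl⟩⟩]
  · rintro ⟨d, hd, rfl | ⟨v, hv, hd', rfl⟩⟩
    exacts [Or.inl ⟨d, hd, rfl⟩, Or.inr ⟨d, hd, v, hv, rfl⟩]

lemma map_old_mem_edges {d : Sym2 X.V} (hd : d ∈ X.edges) : d.map old ∈ (pfwStep X).edges :=
  mem_edges_pfwStep.2 ⟨d, hd, Or.inl rfl⟩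

lemma mk_old_new_mem_edges {d : Sym2 X.V} (hd : d ∈ X.edges) {v : X.V} (hv : v ∈ d) :
    s(old v, new d hd) ∈ (pfwStep X).edges :=
  mem_edges_pfwStep.2 ⟨d, hd, Or.inr ⟨v, hv, hd, rfl⟩⟩

lemma IsChild.mem_of_old_mem {d : Sym2 X.V} {f : Sym2 (pfwStep X).V} (h : IsChild d f) {v : X.V}
    (hv : old v ∈ f) : v ∈ d := by
  rcases h with rfl | ⟨u, hu, hd, rfl⟩
  · simpa using hv
  · simp only [Sym2.mem_iff, old_inj, old_ne_new, or_false] at hv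
    exact hv ▸ hu

lemma IsChild.eq_of_new_mem {d d' : Sym2 X.V} {f : Sym2 (pfwStep X).V} (h : IsChild d f)
    {hd' : d' ∈ X.edges} (hv : new d' hd' ∈ f) : d' = d := by
  rcases h with rfl | ⟨u, hu, hd, rfl⟩
  · simp at hv
  · simpa using hv

lemma IsChild.unique {d d' : Sym2 X.V} {f : Sym2 (pfwStep X).V} (h : IsChild d f)
    (h' : IsChild d' f) : d = d' := by
  rcases h with rfl | ⟨u, hu, hd, rfl⟩
  · rcases h' with h' | ⟨u, hu, hd, h'⟩
    · exact Sym2.map.injective old_injective h'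
    · exact absurd (h' ▸ Sym2.mem_mk_right _ _) new_notMem_map
  · exact h'.eq_of_new_mem (Sym2.mem_mk_right _ _)

/-- The number of edges at hub number `i`. -/
def hubDegree (X : GraphGen) (i : Fin 3) : ℕ := (X.edges.filter (X.hubs i ∈ ·)).card

/-- `X` has no loops and its hubs are pairwise distinct. -/
structure Proper (X : GraphGen) : Prop where
  not_isDiag : ∀ e ∈ X.edges, ¬ e.IsDiag
  hubs_injective : Function.Injective X.hubs

lemma Proper.pfwStep (hX : X.Proper) : (pfwStep X).Proper where
  not_isDiag f hf := by
    obtain ⟨d, hd, rfl | ⟨v, hv, hd', rfl⟩⟩ := mem_edges_pfwStep.1 hf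
    · rw [Sym2.isDiag_map old_injective]
      exact hX.not_isDiag d hd
    · simp
  hubs_injective := old_injective.comp hX.hubs_injective

lemma Proper.exists_other (hX : X.Proper) {e : Sym2 X.V} (he : e ∈ X.edges) {u : X.V}
    (hu : u ∈ e) : ∃ v, v ≠ u ∧ e = s(u, v) := by
  obtain ⟨v, rfl⟩ := hu
  exact ⟨v, fun h => hX.not_isDiag _ he (by simp [h]), rfl⟩

lemma Proper.card_edges_pfwStep (hX : X.Proper) :
    (_root_.pfwStep X).edges.card = 3 * X.edges.card := by
  have hdisj : ∀ d ∈ X.edges, ((_root_.pfwStep X).edges.filter (IsChild d)).card = 3 := by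
    intro d hd
    obtain ⟨u, hu⟩ : ∃ u, u ∈ d := ⟨_, d.out_fst_mem⟩
    obtain ⟨v, hvu, rfl⟩ := hX.exists_other hd hu
    have : (_root_.pfwStep X).edges.filter (IsChild s(u, v)) =
        {s(old u, old v), s(old u, new s(u, v) hd), s(old v, new s(u, v) hd)} := by
      ext f
      simp only [Finset.mem_filter, Finset.mem_insert, Finset.mem_singleton]
      constructor
      · rintro ⟨-, rfl | ⟨w, hw, _, rfl⟩⟩
        · exact Or.inl rfl
        · rcases Sym2.mem_iff.1 hw with rfl | rfl
          exacts [Or.inr (Or.inl rfl), Or.inr (Or.inr rfl)]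
      · have aux : ∀ f, IsChild s(u, v) f →
            f ∈ (_root_.pfwStep X).edges ∧ IsChild s(u, v) f :=
          fun f hf => ⟨mem_edges_pfwStep.2 ⟨_, hd, hf⟩, hf⟩
        rintro (rfl | rfl | rfl)
        · exact aux _ (Or.inl rfl)
        · exact aux _ (Or.inr ⟨u, by simp, hd, rfl⟩)
        · exact aux _ (Or.inr ⟨v, by simp, hd, rfl⟩)
    rw [this, Finset.card_eq_three]
    exact ⟨_, _, _, by simp, by simp, by simpa using hvu.symm, rfl⟩
  have hunion : (_root_.pfwStep X).edges =
      X.edges.biUnion fun d => (_root_.pfwStep X).edges.filter (IsChild d) := by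
    ext f
    simp only [Finset.mem_biUnion, Finset.mem_filter]
    refine ⟨fun hf => ?_, fun ⟨_, _, hf, _⟩ => hf⟩
    obtain ⟨d, hd, h⟩ := mem_edges_pfwStep.1 hf
    exact ⟨d, hd, hf, h⟩
  rw [hunion, Finset.card_biUnion, Finset.sum_congr rfl hdisj]
  · simp [mul_comm]
  · intro d _ d' _ hne
    refine Finset.disjoint_filter.2 fun f _ h h' => hne (h.unique h')

lemma hubDegree_pfwStep (i : Fin 3) : hubDegree (pfwStep X) i = 2 * hubDegree X i := by
  have hfib : ∀ d ∈ X.edges.filter (X.hubs i ∈ ·),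
      (((pfwStep X).edges.filter ((pfwStep X).hubs i ∈ ·)).filter (IsChild d)).card = 2 := by
    intro d hd
    obtain ⟨hd, hi⟩ := Finset.mem_filter.1 hd
    have : ((pfwStep X).edges.filter ((pfwStep X).hubs i ∈ ·)).filter (IsChild d) =
        {d.map old, s(old (X.hubs i), new d hd)} := by
      ext f
      simp only [Finset.mem_filter, Finset.mem_insert, Finset.mem_singleton]
      constructor
      · rintro ⟨⟨-, hf⟩, rfl | ⟨w, hw, _, rfl⟩⟩
        · exact Or.inl rfl
        · right
          simp only [hubs_pfwStep, Sym2.mem_iff, old_inj, old_ne_new, or_false] at hf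
          rw [hf]
      · rintro (rfl | rfl)
        · exact ⟨⟨map_old_mem_edges hd, by simpa using hi⟩, Or.inl rfl⟩
        · exact ⟨⟨mk_old_new_mem_edges hd hi, by simp⟩, Or.inr ⟨_, hi, hd, rfl⟩⟩
    rw [this, Finset.card_pair]
    intro h
    exact new_notMem_map (h ▸ Sym2.mem_mk_right _ _)
  have hunion : (pfwStep X).edges.filter ((pfwStep X).hubs i ∈ ·) =
      (X.edges.filter (X.hubs i ∈ ·)).biUnion fun d =>
        ((pfwStep X).edges.filter ((pfwStep X).hubs i ∈ ·)).filter (IsChild d) := by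
    ext f
    simp only [Finset.mem_biUnion, Finset.mem_filter]
    refine ⟨fun ⟨hf, hi⟩ => ?_, fun ⟨_, _, hf, _⟩ => hf⟩
    obtain ⟨d, hd, h⟩ := mem_edges_pfwStep.1 hf
    exact ⟨d, ⟨hd, h.mem_of_old_mem hi⟩, ⟨hf, hi⟩, h⟩
  unfold hubDegree
  rw [hunion, Finset.card_biUnion, Finset.sum_congr rfl hfib]
  · simp [mul_comm]
  · intro d _ d' _ hne
    refine Finset.disjoint_filter.2 fun f _ h h' => hne (h.unique h')

/-! ### Lower bounds -/

/-- `f` is one of the nine edges, two generations later, arising from the edge `e`. -/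
def IsGrandchild (e : Sym2 X.V) (f : Sym2 (pfwStep (pfwStep X)).V) : Prop :=
  ∃ d, IsChild e d ∧ IsChild d f

lemma dominated_iff {F : Finset (Sym2 X.V)} {u v : X.V} :
    Dominated X F s(u, v) ↔ (∃ f ∈ F, u ∈ f) ∨ ∃ f ∈ F, v ∈ f := by
  constructor
  · rintro (h | ⟨f, hf, w, hw, hwf⟩)
    · exact Or.inl ⟨_, h, by simp⟩
    · rcases Sym2.mem_iff.1 hw with rfl | rfl
      exacts [Or.inl ⟨f, hf, hwf⟩, Or.inr ⟨f, hf, hwf⟩]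
  · rintro (⟨f, hf, h⟩ | ⟨f, hf, h⟩)
    exacts [Or.inr ⟨f, hf, u, by simp, h⟩, Or.inr ⟨f, hf, v, by simp, h⟩]

lemma exists_isChild_of_new_mem {F : Finset (Sym2 (pfwStep X).V)} (hF : F ⊆ (pfwStep X).edges)
    {d : Sym2 X.V} {hd : d ∈ X.edges} (h : ∃ f ∈ F, new d hd ∈ f) : ∃ f ∈ F, IsChild d f := by
  obtain ⟨f, hf, hdf⟩ := h
  obtain ⟨d', hd', hc⟩ := mem_edges_pfwStep.1 (hF hf)
  obtain rfl := hc.eq_of_new_mem hdf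
  exact ⟨f, hf, hc⟩

lemma exists_isGrandchild {F : Finset (Sym2 (pfwStep (pfwStep X)).V)}
    (hF : Admissible (pfwStep (pfwStep X)) F) {e : Sym2 X.V} (he : e ∈ X.edges) :
    ∃ f ∈ F, IsGrandchild e f := by
  obtain ⟨u, hu⟩ : ∃ u, u ∈ e := ⟨_, e.out_fst_mem⟩
  have hd := mk_old_new_mem_edges he hu
  have hdom : Dominated _ F s(old (new e he), new _ hd) := by
    by_contra hnd
    obtain ⟨i, -, hi⟩ := hF.2 _ (mk_old_new_mem_edges hd (Sym2.mem_mk_right _ _)) hnd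
    simp at hi
  rcases dominated_iff.1 hdom with ⟨f, hf, hm⟩ | h
  · obtain ⟨d', hd', hc⟩ := mem_edges_pfwStep.1 (hF.1 hf)
    obtain ⟨e', he', hc'⟩ := mem_edges_pfwStep.1 hd'
    obtain rfl := hc'.eq_of_new_mem (hc.mem_of_old_mem hm)
    exact ⟨f, hf, d', hc', hc⟩
  · obtain ⟨f, hf, hc⟩ := exists_isChild_of_new_mem hF.1 h
    exact ⟨f, hf, _, Or.inr ⟨u, hu, he, rfl⟩, hc⟩

lemma sum_card_isGrandchild_le (F : Finset (Sym2 (pfwStep (pfwStep X)).V)) :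
    ∑ e ∈ X.edges, (F.filter (IsGrandchild e)).card ≤ F.card := by
  rw [← Finset.card_biUnion]
  · exact Finset.card_le_card (Finset.biUnion_subset.2 fun e _ => Finset.filter_subset _ _)
  · intro e _ e' _ hne
    refine Finset.disjoint_filter.2 fun f _ ⟨d, h₁, h₂⟩ ⟨d', h₁', h₂'⟩ => hne ?_
    obtain rfl := h₂.unique h₂'
    exact h₁.unique h₁'

lemma one_le_card_isGrandchild {F : Finset (Sym2 (pfwStep (pfwStep X)).V)}
    (hF : Admissible (pfwStep (pfwStep X)) F) {e : Sym2 X.V} (he : e ∈ X.edges) :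
    1 ≤ (F.filter (IsGrandchild e)).card := by
  obtain ⟨f, hf, h⟩ := exists_isGrandchild hF he
  exact Finset.card_pos.2 ⟨f, Finset.mem_filter.2 ⟨hf, h⟩⟩

lemma card_edges_le_card {F : Finset (Sym2 (pfwStep (pfwStep X)).V)}
    (hF : Admissible (pfwStep (pfwStep X)) F) : X.edges.card ≤ F.card := by
  refine le_trans ?_ (sum_card_isGrandchild_le F)
  simpa using Finset.sum_le_sum fun e he => one_le_card_isGrandchild hF he

lemma card_edges_add_hubDegree_le_card {F : Finset (Sym2 (pfwStep (pfwStep X)).V)}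
    (hF : Admissible (pfwStep (pfwStep X)) F) {i : Fin 3}
    (hi : EmptyHub (pfwStep (pfwStep X)) F i) : X.edges.card + hubDegree X i ≤ F.card := by
  refine le_trans ?_ (sum_card_isGrandchild_le F)
  rw [hubDegree, Finset.card_filter, Finset.card_eq_sum_ones, ← Finset.sum_add_distrib]
  refine Finset.sum_le_sum fun e he => ?_
  split_ifs with hie
  · have key : ∀ d, IsChild e d → old (X.hubs i) ∈ d → ∃ f ∈ F, IsChild d f := by
      intro d hd hid
      have hdE := mem_edges_pfwStep.2 ⟨e, he, hd⟩
      have hdom : Dominated _ F s(old (old (X.hubs i)), new d hdE) := by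
        by_contra hnd
        exact hi.2 ⟨hi.1, _, mk_old_new_mem_edges hdE hid, by simp, hnd⟩
      exact exists_isChild_of_new_mem hF.1 ((dominated_iff.1 hdom).resolve_left hi.1)
    have h₁ : IsChild e (e.map old) := Or.inl rfl
    have h₂ : IsChild e s(old (X.hubs i), new e he) := Or.inr ⟨_, hie, he, rfl⟩
    obtain ⟨f₁, hf₁, hc₁⟩ := key _ h₁ (by simpa using hie)
    obtain ⟨f₂, hf₂, hc₂⟩ := key _ h₂ (by simp)
    have hne : f₁ ≠ f₂ := by
      rintro rfl
      exact new_notMem_map (hc₁.unique hc₂ ▸ Sym2.mem_mk_right _ _)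
    exact Finset.one_lt_card.2 ⟨f₁, Finset.mem_filter.2 ⟨hf₁, _, h₁, hc₁⟩, f₂,
      Finset.mem_filter.2 ⟨hf₂, _, h₂, hc₂⟩, hne⟩
  · exact one_le_card_isGrandchild hF he

/-! ### Constructions -/

/-- `g` assigns to some edges one of their endpoints, the vertices hit being exactly those other
than the hubs with index in `O`. -/
def IsSelection (X : GraphGen) (O : Finset (Fin 3)) (g : Sym2 X.V → Option X.V) : Prop :=
  (∀ e ∈ X.edges, ∀ z, g e = some z → z ∈ e ∧ ∀ i ∈ O, z ≠ X.hubs i) ∧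
    ∀ z, (∀ i ∈ O, z ≠ X.hubs i) → ∃ e ∈ X.edges, g e = some z

lemma exists_isSelection_pfwStep {O : Finset (Fin 3)}
    (h : ∃ g, X.IsSelection O g) : ∃ g, (pfwStep X).IsSelection O g := by
  obtain ⟨g, hg₁, hg₂⟩ := h
  let g' : Sym2 (pfwStep X).V → Option (pfwStep X).V := fun f =>
    if h : ∃ d, ∃ hd : d ∈ X.edges, new d hd ∈ f then some (new h.choose h.choose_spec.choose)
    else if h : ∃ e : Sym2 X.V, f = e.map old then (g h.choose).map old else none
  have hold : ∀ e, g' (e.map old) = (g e).map old := by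
    intro e
    have h₁ : ¬ ∃ d, ∃ hd : d ∈ X.edges, new d hd ∈ e.map old := by simp
    have h₂ : ∃ e' : Sym2 X.V, e.map old = e'.map old := ⟨e, rfl⟩
    simp only [g', dif_neg h₁, dif_pos h₂]
    rw [← Sym2.map.injective old_injective h₂.choose_spec]
  have hnew : ∀ d hd v, g' s(old v, new d hd) = some (new d hd) := by
    intro d hd v
    have h₁ : ∃ d', ∃ hd' : d' ∈ X.edges, new d' hd' ∈ s(old v, new d hd) := ⟨d, hd, by simp⟩
    simp only [g', dif_pos h₁]
    have := h₁.choose_spec.choose_spec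
    simpa using this
  refine ⟨g', fun f hf z hz => ?_, fun z hz => ?_⟩
  · obtain ⟨d, hd, rfl | ⟨v, hv, hd', rfl⟩⟩ := mem_edges_pfwStep.1 hf
    · rw [hold, Option.map_eq_some_iff] at hz
      obtain ⟨w, hw, rfl⟩ := hz
      simpa using hg₁ d hd w hw
    · rw [hnew, Option.some_inj] at hz
      subst hz
      simp
  · obtain ⟨v, rfl⟩ | ⟨d, hd, rfl⟩ := eq_old_or_eq_new z
    · obtain ⟨e, he, hge⟩ := hg₂ v (by simpa using hz)
      exact ⟨_, map_old_mem_edges he, by simp [hold, hge]⟩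
    · exact ⟨_, mk_old_new_mem_edges hd d.out_fst_mem, hnew _ _ _⟩

/-- The edge joining the vertex attached to `e` to the endpoint `g e`, or, if there is none, to
the vertex which the following generation attaches to the edge between `p e` and that vertex. -/
def selectedEdge (g : Sym2 X.V → Option X.V) (p : Sym2 X.V → X.V) (hp : ∀ e, p e ∈ e)
    (e : Sym2 X.V) (he : e ∈ X.edges) : Sym2 (pfwStep (pfwStep X)).V :=
  match g e with
  | some z => s(old (old z), old (new e he))
  | none => s(old (new e he), new s(old (p e), new e he) (mk_old_new_mem_edges he (hp e)))

/-- The set of all selected edges. -/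
def selectedEdges (g : Sym2 X.V → Option X.V) (p : Sym2 X.V → X.V) (hp : ∀ e, p e ∈ e) :
    Finset (Sym2 (pfwStep (pfwStep X)).V) :=
  X.edges.attach.image fun e : {e // e ∈ X.edges} => selectedEdge g p hp e.1 e.2

variable {g : Sym2 X.V → Option X.V} {p : Sym2 X.V → X.V} {hp : ∀ e, p e ∈ e}

lemma mem_selectedEdges {f : Sym2 (pfwStep (pfwStep X)).V} :
    f ∈ selectedEdges g p hp ↔ ∃ e, ∃ he : e ∈ X.edges, selectedEdge g p hp e he = f := by
  refine Finset.mem_image.trans ⟨?_, ?_⟩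
  · rintro ⟨e, -, rfl⟩
    exact ⟨e.1, e.2, rfl⟩
  · rintro ⟨e, he, rfl⟩
    exact ⟨⟨e, he⟩, Finset.mem_attach _ _, rfl⟩

lemma card_selectedEdges_le : (selectedEdges g p hp).card ≤ X.edges.card :=
  Finset.card_image_le.trans (by simp)

lemma selectedEdges_subset (hg : ∀ e ∈ X.edges, ∀ z, g e = some z → z ∈ e) :
    selectedEdges g p hp ⊆ (pfwStep (pfwStep X)).edges := by
  intro f hf
  obtain ⟨e, he, rfl⟩ := mem_selectedEdges.1 hf
  unfold selectedEdge
  split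
  · next z hz => exact map_old_mem_edges (mk_old_new_mem_edges he (hg e he z hz))
  · exact mk_old_new_mem_edges _ (Sym2.mem_mk_right _ _)

lemma old_new_mem_selectedEdge {e : Sym2 X.V} {he : e ∈ X.edges} :
    old (new e he) ∈ selectedEdge g p hp e he := by
  unfold selectedEdge
  split <;> simp

lemma old_old_mem_selectedEdge {e : Sym2 X.V} {he : e ∈ X.edges} {z : X.V} :
    old (old z) ∈ selectedEdge g p hp e he ↔ g e = some z := by
  unfold selectedEdge
  split
  · next w hw => simp [hw, eq_comm]
  · next hn => simp [hn]

lemma new_map_notMem_selectedEdge {e d : Sym2 X.V} {he : e ∈ X.edges}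
    {hd : d.map old ∈ (pfwStep X).edges} :
    new (d.map old) hd ∉ selectedEdge g p hp e he := by
  unfold selectedEdge
  split
  · simp
  · simp only [Sym2.mem_iff, new_ne_old, new_inj, false_or]
    intro h
    exact new_notMem_map (h ▸ Sym2.mem_mk_right _ _)

lemma exists_old_mem {f : Sym2 (pfwStep (pfwStep X)).V} (hf : f ∈ (pfwStep (pfwStep X)).edges) :
    (∃ z, old (old z) ∈ f) ∨ ∃ e he, old (new (X := X) e he) ∈ f := by
  have key : ∃ x, old x ∈ f := by
    obtain ⟨d, hd, rfl | ⟨v, hv, hd', rfl⟩⟩ := mem_edges_pfwStep.1 hf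
    · exact ⟨(Quot.out d).1, by simpa using d.out_fst_mem⟩
    · exact ⟨v, by simp⟩
  obtain ⟨x, hx⟩ := key
  obtain ⟨v, rfl⟩ | ⟨e, he, rfl⟩ := eq_old_or_eq_new x
  exacts [Or.inl ⟨v, hx⟩, Or.inr ⟨e, he, hx⟩]

lemma admissible_of_forall {F : Finset (Sym2 (pfwStep (pfwStep X)).V)}
    (hF : F ⊆ (pfwStep (pfwStep X)).edges)
    (hnew : ∀ e, ∀ he : e ∈ X.edges, ∃ f ∈ F, old (new e he) ∈ f)
    (hold : ∀ z, (∀ i, z ≠ X.hubs i) → ∃ f ∈ F, old (old z) ∈ f) :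
    Admissible (pfwStep (pfwStep X)) F := by
  refine ⟨hF, fun f hf hnd => ?_⟩
  have hcov : ∀ v ∈ f, ¬ ∃ f' ∈ F, v ∈ f' := fun v hv ⟨f', hf', hv'⟩ =>
    hnd (Or.inr ⟨f', hf', v, hv, hv'⟩)
  obtain ⟨z, hz⟩ | ⟨e, he, h⟩ := exists_old_mem hf
  · by_cases hi : ∃ i, z = X.hubs i
    · obtain ⟨i, rfl⟩ := hi
      exact ⟨i, ⟨hcov _ hz, f, hf, hz, hnd⟩, hz⟩
    · push Not at hi
      exact absurd (hold z hi) (hcov _ hz)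
  · exact absurd (hnew e he) (hcov _ h)

lemma numFilled_eq {F : Finset (Sym2 X.V)} {O : Finset (Fin 3)}
    (h : ∀ i, FilledHub X F i ↔ i ∉ O) : numFilled X F = 3 - O.card := by
  simp only [numFilled, h]
  rw [← Finset.compl_filter, Finset.card_compl]
  simp

lemma exists_admissible_of_isSelection (hX : X.Proper) (hdeg : ∀ i, 0 < hubDegree X i)
    {O : Finset (Fin 3)} (hg : X.IsSelection O g) :
    ∃ F, Admissible (pfwStep (pfwStep X)) F ∧ numFilled (pfwStep (pfwStep X)) F = 3 - O.card ∧
      numCross (pfwStep (pfwStep X)) F = O.card ∧ F.card ≤ X.edges.card := by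
  let F := selectedEdges g (fun e => (Quot.out e).1) fun e => e.out_fst_mem
  have hfill : ∀ i, FilledHub (pfwStep (pfwStep X)) F i ↔ i ∉ O := by
    intro i
    constructor
    · rintro ⟨f, hf, hi⟩ hO
      obtain ⟨e, he, rfl⟩ := mem_selectedEdges.1 hf
      exact (hg.1 e he _ (old_old_mem_selectedEdge.1 hi)).2 i hO rfl
    · intro hO
      obtain ⟨e, he, h⟩ := hg.2 (X.hubs i) fun j hj hij => hO (hX.hubs_injective hij ▸ hj)
      exact ⟨_, mem_selectedEdges.2 ⟨e, he, rfl⟩, old_old_mem_selectedEdge.2 h⟩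
  have hcross : ∀ i, CrossHub (pfwStep (pfwStep X)) F i ↔ i ∈ O := by
    intro i
    refine ⟨fun h => not_not.1 fun hO => h.1 ((hfill i).2 hO), fun hO => ?_⟩
    have hnf : ¬ FilledHub (pfwStep (pfwStep X)) F i := fun h => (hfill i).1 h hO
    obtain ⟨e, he⟩ := Finset.card_pos.1 (hdeg i)
    obtain ⟨he, hi⟩ := Finset.mem_filter.1 he
    refine ⟨hnf, s(old (old (X.hubs i)), new (e.map old) (map_old_mem_edges he)),
      mk_old_new_mem_edges _ (by simpa using hi), by simp, fun hdom => ?_⟩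
    rcases dominated_iff.1 hdom with h | ⟨f, hf, h⟩
    · exact hnf h
    · obtain ⟨e', he', rfl⟩ := mem_selectedEdges.1 hf
      exact new_map_notMem_selectedEdge h
  refine ⟨F, admissible_of_forall (selectedEdges_subset fun e he z hz => (hg.1 e he z hz).1)
    (fun e he => ⟨_, mem_selectedEdges.2 ⟨e, he, rfl⟩, old_new_mem_selectedEdge⟩) (fun z hz => ?_),
    ?_, ?_, card_selectedEdges_le⟩
  · obtain ⟨e, he, h⟩ := hg.2 z fun i _ => hz i
    exact ⟨_, mem_selectedEdges.2 ⟨e, he, rfl⟩, old_old_mem_selectedEdge.2 h⟩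
  · exact numFilled_eq hfill
  · simp [numCross, hcross]

lemma exists_admissible_emptyHub (hX : X.Proper) {i : Fin 3} (hg : X.IsSelection {i} g) :
    ∃ F, Admissible (pfwStep (pfwStep X)) F ∧ numFilled (pfwStep (pfwStep X)) F = 2 ∧
      numCross (pfwStep (pfwStep X)) F = 0 ∧ F.card ≤ X.edges.card + hubDegree X i := by
  have hother : ∀ e : {e // e ∈ X.edges.filter (X.hubs i ∈ ·)},
      ∃ v, v ≠ X.hubs i ∧ e.1 = s(X.hubs i, v) := fun e =>
    hX.exists_other (Finset.mem_filter.1 e.2).1 (Finset.mem_filter.1 e.2).2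
  choose v hv hev using hother
  have hve : ∀ e, v e ∈ e.1 := fun e => by
    rw [hev e]
    exact Sym2.mem_mk_right _ _
  have hmem : ∀ e : {e // e ∈ X.edges.filter (X.hubs i ∈ ·)}, e.1 ∈ X.edges := fun e =>
    (Finset.mem_filter.1 e.2).1
  let g' : Sym2 X.V → Option X.V := fun e => if X.hubs i ∈ e then none else g e
  let p : Sym2 X.V → X.V := fun e => if X.hubs i ∈ e then X.hubs i else e.out.1
  have hp : ∀ e, p e ∈ e := by
    intro e
    simp only [p]
    split_ifs with h
    exacts [h, e.out_fst_mem]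
  let F₂ : Finset (Sym2 (pfwStep (pfwStep X)).V) := Finset.univ.image fun e =>
    s(old (old (v e)), new (e.1.map old) (map_old_mem_edges (hmem e)))
  let F := selectedEdges g' p hp ∪ F₂
  have hF₁ : ∀ e, ∀ he : e ∈ X.edges, selectedEdge g' p hp e he ∈ F := fun e he =>
    Finset.mem_union_left _ (mem_selectedEdges.2 ⟨e, he, rfl⟩)
  have hF₂ : ∀ e, s(old (old (v e)), new (e.1.map old) (map_old_mem_edges (hmem e))) ∈ F :=
    fun e => Finset.mem_union_right _ (Finset.mem_image_of_mem _ (Finset.mem_univ e))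
  have hg' : ∀ e ∈ X.edges, ∀ z, g' e = some z → z ∈ e ∧ z ≠ X.hubs i := by
    intro e he z hz
    simp only [g'] at hz
    split_ifs at hz
    exact ⟨(hg.1 e he z hz).1, (hg.1 e he z hz).2 i (by simp)⟩
  have hsub : F ⊆ (pfwStep (pfwStep X)).edges := by
    refine Finset.union_subset (selectedEdges_subset fun e he z hz => (hg' e he z hz).1) ?_
    intro f hf
    obtain ⟨e, -, rfl⟩ := Finset.mem_image.1 hf
    exact mk_old_new_mem_edges _ (old_mem_map.2 (hve e))
  have hcov : ∀ z, z ≠ X.hubs i → ∃ f ∈ F, old (old z) ∈ f := by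
    intro z hz
    obtain ⟨e, he, h⟩ := hg.2 z (by simpa using hz)
    by_cases hie : X.hubs i ∈ e
    · let e' : {e // e ∈ X.edges.filter (X.hubs i ∈ ·)} := ⟨e, Finset.mem_filter.2 ⟨he, hie⟩⟩
      have hze : z ∈ s(X.hubs i, v e') := hev e' ▸ (hg.1 e he z h).1
      obtain rfl := (Sym2.mem_iff.1 hze).resolve_left hz
      exact ⟨_, hF₂ e', Sym2.mem_mk_left _ _⟩
    · exact ⟨_, hF₁ e he, old_old_mem_selectedEdge.2 (by simp [g', hie, h])⟩
  have hcovnew : ∀ e, ∀ he : e ∈ X.edges, ∃ f ∈ F, old (new e he) ∈ f := fun e he =>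
    ⟨_, hF₁ e he, old_new_mem_selectedEdge⟩
  have hfill : ∀ j, FilledHub (pfwStep (pfwStep X)) F j ↔ j ∉ ({i} : Finset (Fin 3)) := by
    intro j
    rw [Finset.mem_singleton]
    refine ⟨?_, fun h => hcov _ fun h' => h (hX.hubs_injective h')⟩
    rintro ⟨f, hf, hj⟩ rfl
    rcases Finset.mem_union.1 hf with hf | hf
    · obtain ⟨e, he, rfl⟩ := mem_selectedEdges.1 hf
      exact (hg' e he _ (old_old_mem_selectedEdge.1 hj)).2 rfl
    · obtain ⟨e, -, rfl⟩ := Finset.mem_image.1 hf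
      exact hv e (by simpa [eq_comm] using hj)
  have hcross : ∀ j, ¬ CrossHub (pfwStep (pfwStep X)) F j := by
    rintro j ⟨hnf, f, hf, hjf, hnd⟩
    obtain rfl : j = i := by simpa [hfill] using hnf
    have hunc : ∀ x ∈ f, ¬ ∃ f' ∈ F, x ∈ f' := fun x hx ⟨f', hf', hx'⟩ =>
      hnd (Or.inr ⟨f', hf', x, hx, hx'⟩)
    obtain ⟨d, hd, hdf⟩ := mem_edges_pfwStep.1 hf
    have hjd := hdf.mem_of_old_mem hjf
    obtain ⟨e, he, hed⟩ := mem_edges_pfwStep.1 hd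
    have hje := hed.mem_of_old_mem hjd
    let e' : {e // e ∈ X.edges.filter (X.hubs j ∈ ·)} := ⟨e, Finset.mem_filter.2 ⟨he, hje⟩⟩
    rcases hdf with rfl | ⟨x, hx, hd', rfl⟩
    · rcases hed with rfl | ⟨y, hy, he', rfl⟩
      · refine hunc (old (old (v e'))) ?_ ⟨_, hF₂ e', Sym2.mem_mk_left _ _⟩
        rw [old_mem_map, old_mem_map]
        exact hve e'
      · exact hunc (old (new e he)) (by simp) (hcovnew e he)
    · rcases hed with rfl | ⟨y, hy, he', rfl⟩
      · exact hunc (new (e.map old) hd') (by simp) ⟨_, hF₂ e', Sym2.mem_mk_right _ _⟩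
      · obtain rfl : X.hubs j = y := by simpa using hjd
        refine hunc (new _ hd') (by simp) ⟨_, hF₁ e he, ?_⟩
        simp [selectedEdge, g', p, hje]
  refine ⟨F, admissible_of_forall hsub hcovnew fun z hz => hcov z (hz i), ?_, ?_, ?_⟩
  · exact numFilled_eq hfill
  · simp [numCross, hcross]
  · refine (Finset.card_union_le _ _).trans (add_le_add card_selectedEdges_le ?_)
    exact Finset.card_image_le.trans (by simp [hubDegree])

lemma minAdm_eq_of_exists {nf k N : ℕ}
    (hle : ∀ F, Admissible X F → numFilled X F = nf → numCross X F = k → N ≤ F.card)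
    (hex : ∃ F, Admissible X F ∧ numFilled X F = nf ∧ numCross X F = k ∧ F.card ≤ N) :
    minAdm X nf k = N := by
  obtain ⟨F, h₁, h₂, h₃, h₄⟩ := hex
  have hF : F.card = N := le_antisymm h₄ (hle F h₁ h₂ h₃)
  refine le_antisymm (Nat.sInf_le ⟨F, h₁, h₂, h₃, hF⟩) (le_csInf ⟨N, F, h₁, h₂, h₃, hF⟩ ?_)
  rintro _ ⟨F', h₁', h₂', h₃', rfl⟩
  exact hle F' h₁' h₂' h₃'

lemma exists_emptyHub {F : Finset (Sym2 X.V)} (h₁ : numFilled X F = 2) (h₂ : numCross X F = 0) :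
    ∃ i, EmptyHub X F i := by
  have hcross : ∀ i, ¬ CrossHub X F i := by
    simpa [numCross, Finset.filter_eq_empty_iff] using h₂
  by_contra! h
  have hfill : ∀ i, FilledHub X F i := fun i => not_not.1 fun hi => h i ⟨hi, hcross i⟩
  simp [numFilled, hfill] at h₁

lemma minAdm_pfwStep_pfwStep (hX : X.Proper) (hdeg : ∀ i, 0 < hubDegree X i)
    {O : Finset (Fin 3)} (hg : ∃ g, X.IsSelection O g) :
    minAdm (pfwStep (pfwStep X)) (3 - O.card) O.card = X.edges.card :=
  minAdm_eq_of_exists (fun _ hF _ _ => card_edges_le_card hF)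
    (hg.elim fun _ hg => exists_admissible_of_isSelection hX hdeg hg)

lemma minAdm_two_zero_pfwStep_pfwStep (hX : X.Proper) {δ : ℕ} (hdeg : ∀ i, hubDegree X i = δ)
    {i : Fin 3} (hg : ∃ g, X.IsSelection {i} g) :
    minAdm (pfwStep (pfwStep X)) 2 0 = X.edges.card + δ := by
  refine minAdm_eq_of_exists (fun F hF h₁ h₂ => ?_) ?_
  · obtain ⟨j, hj⟩ := exists_emptyHub h₁ h₂
    exact hdeg j ▸ card_edges_add_hubDegree_le_card hF hj
  · obtain ⟨g, hg⟩ := hg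
    exact hdeg i ▸ exists_admissible_emptyHub hX hg

/-! ### The pseudofractal web -/

lemma mem_edges_triangle {e : Sym2 (Fin 3)} :
    e ∈ triangle.edges ↔ e = s(0, 1) ∨ e = s(0, 2) ∨ e = s(1, 2) := by
  refine (Finset.mem_insert (α := Sym2 (Fin 3))).trans (or_congr Iff.rfl ?_)
  exact (Finset.mem_insert (α := Sym2 (Fin 3))).trans
    (or_congr Iff.rfl (Finset.mem_singleton (α := Sym2 (Fin 3))))

lemma proper_triangle : triangle.Proper where
  not_isDiag e he := by
    have aux : ∀ e : Sym2 (Fin 3), e = s(0, 1) ∨ e = s(0, 2) ∨ e = s(1, 2) → ¬ e.IsDiag := by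
      rintro e (rfl | rfl | rfl) <;> simp
    exact aux e (mem_edges_triangle.1 he)
  hubs_injective := fun _ _ h => h

lemma hubDegree_triangle (i : Fin 3) : hubDegree triangle i = 2 := by
  have key : ∀ i : Fin 3,
      (({s(0, 1), s(0, 2), s(1, 2)} : Finset (Sym2 (Fin 3))).filter (i ∈ ·)).card = 2 := by
    decide
  unfold hubDegree
  convert key i <;> rfl

/-- The selection on the triangle taking the endpoints `x`, `y`, `z` of its three edges. -/
def triangleSelection (x y z : Option (Fin 3)) (e : Sym2 (Fin 3)) : Option (Fin 3) :=
  if e = s(0, 1) then x else if e = s(0, 2) then y else z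

lemma exists_isSelection_triangle {O : Finset (Fin 3)} (hO : O = ∅ ∨ O = {2} ∨ O = {1, 2}) :
    ∃ g, triangle.IsSelection O g := by
  have key : ∀ x y z : Option (Fin 3),
      (∀ w, (x = some w → w ∈ s((0 : Fin 3), 1) ∧ w ∉ O) ∧
        (y = some w → w ∈ s((0 : Fin 3), 2) ∧ w ∉ O) ∧
        (z = some w → w ∈ s((1 : Fin 3), 2) ∧ w ∉ O)) →
      (∀ w, w ∉ O → x = some w ∨ y = some w ∨ z = some w) →
      ∃ g, triangle.IsSelection O g := by
    intro x y z h₁ h₂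
    have hx : triangleSelection x y z s(0, 1) = x := by simp [triangleSelection]
    have hy : triangleSelection x y z s(0, 2) = y := by simp [triangleSelection]
    have hz : triangleSelection x y z s(1, 2) = z := by simp [triangleSelection]
    refine ⟨triangleSelection x y z, fun e he w hw => ?_, fun w hw => ?_⟩
    · have aux : w ∈ e ∧ w ∉ O := by
        rcases mem_edges_triangle.1 he with rfl | rfl | rfl
        · exact (h₁ w).1 (hx.symm.trans hw)
        · exact (h₁ w).2.1 (hy.symm.trans hw)
        · exact (h₁ w).2.2 (hz.symm.trans hw)
      exact ⟨aux.1, fun i hi h => aux.2 (h ▸ hi)⟩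
    · rcases h₂ w fun h => hw w h rfl with h | h | h
      · exact ⟨_, mem_edges_triangle.2 (Or.inl rfl), hx.trans h⟩
      · exact ⟨_, mem_edges_triangle.2 (Or.inr (Or.inl rfl)), hy.trans h⟩
      · exact ⟨_, mem_edges_triangle.2 (Or.inr (Or.inr rfl)), hz.trans h⟩
  rcases hO with rfl | rfl | rfl
  · exact key (some 0) (some 2) (some 1) (fun w => by fin_cases w <;> simp)
      (fun w _ => by fin_cases w <;> simp)
  · refine key (some 0) (some 0) (some 1) (fun w => by fin_cases w <;> simp) (fun w hw => ?_)
    fin_cases w <;> simp at hw ⊢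
  · refine key (some 0) (some 0) none (fun w => by fin_cases w <;> simp) (fun w hw => ?_)
    fin_cases w <;> simp at hw ⊢

lemma pfw_add_two (k : ℕ) : pfw (k + 2) = pfwStep (pfw (k + 1)) := rfl

lemma proper_pfw (k : ℕ) : (pfw (k + 1)).Proper := by
  induction k with
  | zero => exact proper_triangle
  | succ k ih => exact ih.pfwStep

lemma hubDegree_pfw (k : ℕ) (i : Fin 3) : hubDegree (pfw (k + 1)) i = 2 ^ (k + 1) := by
  induction k with
  | zero => exact hubDegree_triangle i
  | succ k ih => rw [pfw_add_two, hubDegree_pfwStep, ih, pow_succ' 2 (k + 1)]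

lemma exists_isSelection_pfw {O : Finset (Fin 3)} (hO : O = ∅ ∨ O = {2} ∨ O = {1, 2}) (k : ℕ) :
    ∃ g, (pfw (k + 1)).IsSelection O g := by
  induction k with
  | zero => exact exists_isSelection_triangle hO
  | succ k ih => exact exists_isSelection_pfwStep ih

lemma card_edges_pfw (k : ℕ) : (pfw (k + 1)).edges.card = 3 ^ (k + 1) := by
  induction k with
  | zero =>
    have h : ({s(0, 1), s(0, 2), s(1, 2)} : Finset (Sym2 (Fin 3))).card = 3 := by decide
    exact h
  | succ k ih => rw [pfw_add_two, (proper_pfw k).card_edges_pfwStep, ih, pow_succ' 3 (k + 1)]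

lemma minAdm_pfw {O : Finset (Fin 3)} (hO : O = ∅ ∨ O = {2} ∨ O = {1, 2}) (k : ℕ) :
    minAdm (pfw (k + 3)) (3 - O.card) O.card = 3 ^ (k + 1) := by
  rw [pfw_add_two, pfw_add_two, ← card_edges_pfw]
  exact minAdm_pfwStep_pfwStep (proper_pfw k) (fun i => by simp [hubDegree_pfw])
    (exists_isSelection_pfw hO k)

lemma bq_two_pfw (k : ℕ) : bq (pfw (k + 3)) 2 = 3 ^ (k + 1) :=
  minAdm_pfw (O := {1, 2}) (by simp) k

lemma cq_one_pfw (k : ℕ) : cq (pfw (k + 3)) 1 = 3 ^ (k + 1) :=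
  minAdm_pfw (O := {2}) (by simp) k

lemma dq_zero_pfw (k : ℕ) : dq (pfw (k + 3)) 0 = 3 ^ (k + 1) :=
  minAdm_pfw (O := ∅) (by simp) k

lemma cq_zero_pfw (k : ℕ) : cq (pfw (k + 3)) 0 = 3 ^ (k + 1) + 2 ^ (k + 1) := by
  rw [cq, pfw_add_two, pfw_add_two, ← card_edges_pfw]
  exact minAdm_two_zero_pfwStep_pfwStep (proper_pfw k) (hubDegree_pfw k) (i := 2)
    (exists_isSelection_pfw (by simp) k)

end GraphGen

end

/-- the simplified recursions `b_{n+1}^2 = 2c_n^1 + b_n^2`,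
`c_{n+1}^1 = 3c_n^1`, `d_{n+1}^0 = 3d_n^0`, `c_{n+1}^0 = 2c_n^0 + c_n^1`
for the pseudofractal scale-free web. -/
theorem pfw_simplified_recursions (n : ℕ) (hn : 3 ≤ n) :
    bq (pfw (n + 1)) 2 = 2 * cq (pfw n) 1 + bq (pfw n) 2 ∧
    cq (pfw (n + 1)) 1 = 3 * cq (pfw n) 1 ∧
    dq (pfw (n + 1)) 0 = 3 * dq (pfw n) 0 ∧
    cq (pfw (n + 1)) 0 = 2 * cq (pfw n) 0 + cq (pfw n) 1 := by
  obtain ⟨k, rfl⟩ := Nat.exists_eq_add_of_le' hn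
  rw [show k + 3 + 1 = k + 1 + 3 from rfl]
  simp only [GraphGen.bq_two_pfw, GraphGen.cq_one_pfw, GraphGen.dq_zero_pfw, GraphGen.cq_zero_pfw]
  refine ⟨?_, ?_, ?_, ?_⟩ <;> ring
end
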